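/- arXiv:1801.00737 — 4 statements merged into one kernel-verified Lean document; each statement's English description precedes it below -/
import Mathlib

section
/- For every integer n ≥ 3: if n is odd then H(n,3) = C(n, ⌊n/2⌋), and if n is even then H(n,3) = (1/2)·C(n, ⌊n/2⌋), where C denotes the binomial coefficient. -/
open SimpleGraph

/-- `G` contains a cycle of length `k` as a subgraph. -/
def ContainsCycleLen {V : Type*} (G : SimpleGraph V) (k : ℕ) : Prop :=
  ∃ (u : V) (w : G.Walk u u), w.IsCycle ∧ w.length = k

/-- `H` is a Hamiltonian path of the complete graph on `Fin n`:
it is the path graph on `n` vertices up to a relabeling of the vertices. -/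
def IsHamPathGraph {n : ℕ} (H : SimpleGraph (Fin n)) : Prop :=
  ∃ σ : Equiv.Perm (Fin n), ∀ a b, H.Adj a b ↔ (pathGraph n).Adj (σ a) (σ b)

/-- The maximum size of a family of Hamiltonian paths of `K_n` that are
pairwise `C_k`-creating. -/
noncomputable def Hnum (n k : ℕ) : ℕ :=
  sSup {m | ∃ F : Finset (SimpleGraph (Fin n)), F.card = m ∧
    (∀ G ∈ F, IsHamPathGraph G) ∧
    ∀ G₁ ∈ F, ∀ G₂ ∈ F, G₁ ≠ G₂ → ContainsCycleLen (G₁ ⊔ G₂) k}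

/-- `H` is a perfect matching (as a graph): every vertex has a unique neighbor. -/
def IsPMGraph {V : Type*} (H : SimpleGraph V) : Prop :=
  ∀ v : V, ∃! w : V, H.Adj v w

/-- The maximum size of a family of perfect matchings of `K_n` that are
pairwise `C_k`-creating. -/
noncomputable def Mnum (n k : ℕ) : ℕ :=
  sSup {m | ∃ F : Finset (SimpleGraph (Fin n)), F.card = m ∧
    (∀ G ∈ F, IsPMGraph G) ∧
    ∀ G₁ ∈ F, ∀ G₂ ∈ F, G₁ ≠ G₂ → ContainsCycleLen (G₁ ⊔ G₂) k}

section Core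

variable {V : Type*}

/-- colour of a block -/
def hcol (c : V → Bool) : List V → Bool
  | [] => false
  | x :: _ => c x

/-- the pairs of elements coming from bichromatic pairs of blocks -/
def dsL (c : V → Bool) : List (List V) → List (V × V)
  | b :: b' :: r => if hcol c b = hcol c b' then dsL c r else List.zip b b' ++ dsL c r
  | _ => []

/-- the merged monochromatic blocks -/
def ssL (c : V → Bool) : List (List V) → List (List V)
  | b :: b' :: r => if hcol c b = hcol c b' then (b ++ b'.reverse) :: ssL c r else ssL c r
  | _ => []

/-- are the first two blocks of the same colour -/
def headSame (c : V → Bool) : List (List V) → Bool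
  | b :: b' :: _ => hcol c b == hcol c b'
  | _ => true

/-- the list of pairs of the path -/
def pairsL (c : V → Bool) : ℕ → List (List V) → List (V × V)
  | 0, _ => []
  | k + 1, L => if headSame c L then pairsL c k (ssL c L) ++ dsL c L
      else dsL c L ++ pairsL c k (ssL c L)

/-- the path -/
def pathL (c : V → Bool) : List (V × V) → List V
  | [] => []
  | p :: R => (if c p.1 then [p.1, p.2] else [p.2, p.1]) ++ pathL c R

/-- balance -/
def balL (c : V → Bool) : List (List V) → ℤ
  | [] => 0
  | b :: r => (if hcol c b then 1 else -1) + balL c r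

structure GoodL (c : V → Bool) (L : List (List V)) : Prop where
  wf : ∃ m > 0, ∀ b ∈ L, b.length = m
  mono : ∀ b ∈ L, ∀ x ∈ b, c x = hcol c b
  bal : balL c L = 0

def Adj1 (l : List V) (x y : V) : Prop := [x, y] <:+: l ∨ [y, x] <:+: l
def Adj2 (l : List V) (x y : V) : Prop := ∃ z, [x, z, y] <:+: l ∨ [y, z, x] <:+: l

theorem pathL_append (c : V → Bool) (R S : List (V × V)) :
    pathL c (R ++ S) = pathL c R ++ pathL c S := by
  induction R with
  | nil => rfl
  | cons p R ih => simp [pathL, ih]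

theorem balL_parity (c : V → Bool) (L : List (List V)) : (balL c L - L.length) % 2 = 0 := by
  induction L with
  | nil => rfl
  | cons b r ih =>
    simp only [balL, List.length_cons]
    push_cast
    split <;> omega

theorem GoodL.even {c : V → Bool} {L : List (List V)} (h : GoodL c L) : L.length % 2 = 0 := by
  have := balL_parity c L
  rw [h.bal] at this
  omega

theorem hcol_append (c : V → Bool) (b b' : List V) (hb : 0 < b.length) :
    hcol c (b ++ b') = hcol c b := by
  cases b with
  | nil => simp at hb
  | cons x t => rfl

theorem ssL_bal (c : V → Bool) : ∀ L : List (List V), L.length % 2 = 0 →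
    (∀ b ∈ L, 0 < b.length) → 2 * balL c (ssL c L) = balL c L
  | [], _, _ => by simp [ssL, balL]
  | [_], h, _ => by simp at h
  | b :: b' :: r, h, hp => by
    have ih := ssL_bal c r (by simp at h; omega) (fun x hx => hp x (by simp [hx]))
    have hb := hp b (by simp)
    simp only [ssL, balL]
    split
    · rename_i e
      simp only [balL, hcol_append c b _ hb, ← e]
      rw [← ih]
      split <;> ring
    · rename_i e
      rw [ih]
      revert e
      cases hcol c b <;> cases hcol c b' <;> simp

theorem ssL_len (c : V → Bool) : ∀ L : List (List V), 2 * (ssL c L).length ≤ L.length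
  | [] => by simp [ssL]
  | [_] => by simp [ssL]
  | b :: b' :: r => by
    have ih := ssL_len c r
    simp only [ssL]
    split <;> simp <;> omega

theorem ssL_mem (c : V → Bool) : ∀ L : List (List V), ∀ s ∈ ssL c L,
    ∃ b ∈ L, ∃ b' ∈ L, hcol c b = hcol c b' ∧ s = b ++ b'.reverse
  | [], s, h => by simp [ssL] at h
  | [_], s, h => by simp [ssL] at h
  | b :: b' :: r, s, h => by
    have ih := ssL_mem c r s
    have key : s ∈ ssL c r → ∃ d ∈ b :: b' :: r, ∃ d' ∈ b :: b' :: r,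
        hcol c d = hcol c d' ∧ s = d ++ d'.reverse := by
      intro hs
      obtain ⟨d, hd, d', hd', e⟩ := ih hs
      exact ⟨d, by simp [hd], d', by simp [hd'], e⟩
    simp only [ssL] at h
    split at h
    · rcases List.mem_cons.1 h with h | h
      · exact ⟨b, by simp, b', by simp, by assumption, h⟩
      · exact key h
    · exact key h

theorem GoodL.ss {c : V → Bool} {L : List (List V)} (h : GoodL c L) : GoodL c (ssL c L) := by
  obtain ⟨m, hm, hw⟩ := h.wf
  refine ⟨⟨2 * m, by omega, ?_⟩, ?_, ?_⟩
  · intro s hs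
    obtain ⟨b, hb, b', hb', e, rfl⟩ := ssL_mem c L s hs
    simp [hw b hb, hw b' hb']; omega
  · intro s hs x hx
    obtain ⟨b, hb, b', hb', e, rfl⟩ := ssL_mem c L s hs
    rw [hcol_append c b _ (by rw [hw b hb]; exact hm)]
    simp at hx
    rcases hx with hx | hx
    · exact h.mono b hb x hx
    · rw [e]; exact h.mono b' hb' x hx
  · have := ssL_bal c L h.even (fun b hb => by rw [hw b hb]; exact hm)
    rw [h.bal] at this
    omega

theorem pathL_mem_infix (c : V → Bool) (R : List (V × V)) (p : V × V) (hp : p ∈ R) :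
    Adj1 (pathL c R) p.1 p.2 := by
  obtain ⟨s, t, rfl⟩ := List.append_of_mem hp
  rw [pathL_append]
  simp only [pathL]
  split
  · exact Or.inl ⟨pathL c s, pathL c t, by simp⟩
  · exact Or.inr ⟨pathL c s, pathL c t, by simp⟩

theorem Adj1.mono {l l' : List V} {x y : V} (h : Adj1 l x y) (hl : l <:+: l') : Adj1 l' x y :=
  h.imp (fun h => h.trans hl) (fun h => h.trans hl)

theorem Adj2.mono {l l' : List V} {x y : V} (h : Adj2 l x y) (hl : l <:+: l') : Adj2 l' x y := by
  obtain ⟨z, h⟩ := h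
  exact ⟨z, h.imp (fun h => h.trans hl) (fun h => h.trans hl)⟩

theorem Adj2.symm {l : List V} {x y : V} (h : Adj2 l x y) : Adj2 l y x := by
  obtain ⟨z, h⟩ := h
  exact ⟨z, h.symm⟩

theorem pathL_infix {c : V → Bool} {R S : List (V × V)} (h : R <:+: S) :
    pathL c R <:+: pathL c S := by
  obtain ⟨s, t, rfl⟩ := h
  exact ⟨pathL c s, pathL c t, by simp [pathL_append]⟩

theorem pairsL_ss (c : V → Bool) (k : ℕ) (L : List (List V)) :
    pairsL c k (ssL c L) <:+: pairsL c (k + 1) L := by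
  simp only [pairsL]
  split
  · exact (List.prefix_append _ _).isInfix
  · exact (List.suffix_append _ _).isInfix

theorem pairsL_ds (c : V → Bool) (k : ℕ) (L : List (List V)) :
    dsL c L <:+: pairsL c (k + 1) L := by
  simp only [pairsL]
  split
  · exact (List.suffix_append _ _).isInfix
  · exact (List.prefix_append _ _).isInfix

theorem step_mem (c : V → Bool) : ∀ L : List (List V), L.length % 2 = 0 → ∀ b ∈ L,
    ∃ b' ∈ L, (List.zip b b' <:+: dsL c L ∨ List.zip b' b <:+: dsL c L) ∨
      (b ++ b'.reverse ∈ ssL c L ∨ b' ++ b.reverse ∈ ssL c L)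
  | [], _, b, hb => by simp at hb
  | [_], h, _, _ => by simp at h
  | d :: d' :: r, h, b, hb => by
    have ih := step_mem c r (by simp at h; omega) b
    by_cases e : hcol c d = hcol c d'
    · simp only [dsL, ssL, if_pos e]
      simp only [List.mem_cons] at hb
      rcases hb with rfl | rfl | hb
      · exact ⟨d', by simp, Or.inr (Or.inl (by simp))⟩
      · exact ⟨d, by simp, Or.inr (Or.inr (by simp))⟩
      · obtain ⟨b', hb', hh⟩ := ih hb
        refine ⟨b', by simp [hb'], ?_⟩
        rcases hh with hh | hh | hh
        · exact Or.inl hh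
        · exact Or.inr (Or.inl (by simp [hh]))
        · exact Or.inr (Or.inr (by simp [hh]))
    · simp only [dsL, ssL, if_neg e]
      simp only [List.mem_cons] at hb
      have p := (List.prefix_append (List.zip d d') (dsL c r)).isInfix
      have q := (List.suffix_append (List.zip d d') (dsL c r)).isInfix
      rcases hb with rfl | rfl | hb
      · exact ⟨d', by simp, Or.inl (Or.inl p)⟩
      · exact ⟨d, by simp, Or.inl (Or.inr p)⟩
      · obtain ⟨b', hb', hh⟩ := ih hb
        refine ⟨b', by simp [hb'], ?_⟩
        rcases hh with (hh | hh) | hh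
        · exact Or.inl (Or.inl (hh.trans q))
        · exact Or.inl (Or.inr (hh.trans q))
        · exact Or.inr hh

theorem zip_infix_left {x y : V} : ∀ (b b' : List V), b.length = b'.length → [x, y] <:+: b →
    ∃ u v, [(x, u), (y, v)] <:+: List.zip b b' := by
  rintro b b' hl ⟨s, t, rfl⟩
  simp at hl
  obtain ⟨s', r', rfl, hs⟩ : ∃ s' r', b' = s' ++ r' ∧ s'.length = s.length :=
    ⟨b'.take s.length, b'.drop s.length, by simp, by simp; omega⟩
  match r', hl with
  | [], hl => simp at hl; omega
  | [_], hl => simp at hl; omega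
  | u :: v :: t', hl =>
    refine ⟨u, v, List.zip s s', List.zip t t', ?_⟩
    rw [List.append_assoc, List.append_assoc, List.zip_append hs.symm]
    simp

theorem zip_infix_right {x y : V} (b b' : List V) (hl : b.length = b'.length)
    (h : [x, y] <:+: b') : ∃ u v, [(u, x), (v, y)] <:+: List.zip b b' := by
  obtain ⟨u, v, s, t, h⟩ := zip_infix_left b' b hl.symm h
  refine ⟨u, v, s.map Prod.swap, t.map Prod.swap, ?_⟩
  rw [← List.zip_swap b' b, ← h]
  simp

theorem dsL_ne (c : V → Bool) : ∀ L : List (List V), (∀ b ∈ L, ∀ x ∈ b, c x = hcol c b) →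
    ∀ p ∈ dsL c L, c p.1 ≠ c p.2
  | [], _, p, h => by simp [dsL] at h
  | [_], _, p, h => by simp [dsL] at h
  | b :: b' :: r, hm, p, h => by
    have ih := dsL_ne c r (fun x hx => hm x (by simp [hx])) p
    simp only [dsL] at h
    split at h
    · exact ih h
    · rename_i e
      rcases List.mem_append.1 h with h | h
      · obtain ⟨x, y⟩ := p
        have := List.of_mem_zip h
        simp only
        rw [hm b (by simp) x this.1, hm b' (by simp) y this.2]
        exact e
      · exact ih h

theorem pairsL_ne (c : V → Bool) (k : ℕ) : ∀ L : List (List V), GoodL c L →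
    ∀ p ∈ pairsL c k L, c p.1 ≠ c p.2 := by
  induction k with
  | zero => intro L _ p h; simp [pairsL] at h
  | succ k ih =>
    intro L hL p hp
    have : p ∈ pairsL c k (ssL c L) ∨ p ∈ dsL c L := by
      simp only [pairsL] at hp
      split at hp
      · exact List.mem_append.1 hp
      · exact (List.mem_append.1 hp).symm
    rcases this with h | h
    · exact ih _ hL.ss p h
    · exact dsL_ne c L hL.mono p h

/-- consecutive pairs with the same orientation -/
theorem path_pairs_adj2 (c : V → Bool) (R : List (V × V)) (p q : V × V) (h : [p, q] <:+: R)
    (e : c p.1 = c q.1) : Adj2 (pathL c R) p.1 q.1 ∧ Adj2 (pathL c R) p.2 q.2 := by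
  have h2 := pathL_infix (c := c) h
  cases hq : c q.1
  · simp only [pathL, e, hq] at h2
    constructor
    · exact Adj2.mono ⟨q.2, Or.inl ⟨[p.2], [], by simp⟩⟩ h2
    · exact Adj2.mono ⟨p.1, Or.inl ⟨[], [q.1], by simp⟩⟩ h2
  · simp only [pathL, e, hq] at h2
    constructor
    · exact Adj2.mono ⟨p.2, Or.inl ⟨[], [q.2], by simp⟩⟩ h2
    · exact Adj2.mono ⟨q.1, Or.inl ⟨[p.1], [], by simp⟩⟩ h2

theorem adj2_of_block (c : V → Bool) (k : ℕ) : ∀ L : List (List V), GoodL c L → L.length ≤ k →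
    ∀ b ∈ L, ∀ x y, [x, y] <:+: b → Adj2 (pathL c (pairsL c k L)) x y := by
  induction k with
  | zero =>
    intro L _ hk b hb
    have : L = [] := List.length_eq_zero_iff.1 (by omega)
    simp [this] at hb
  | succ k ih =>
    intro L hL hk b hb x y hxy
    have hpos : 0 < L.length := List.length_pos_of_mem hb
    have hsl := ssL_len c L
    obtain ⟨m, hm, hw⟩ := hL.wf
    have ih' := ih (ssL c L) hL.ss (by omega)
    have hss := pathL_infix (c := c) (pairsL_ss c k L)
    have hds := pairsL_ds c k L
    obtain ⟨b', hb', h⟩ := step_mem c L hL.even b hb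
    have hlen : b.length = b'.length := by rw [hw b hb, hw b' hb']
    have hx : x ∈ b := hxy.subset (by simp)
    have hy : y ∈ b := hxy.subset (by simp)
    have hcxy : c x = c y := by rw [hL.mono b hb x hx, hL.mono b hb y hy]
    rcases h with (h | h) | (h | h)
    · obtain ⟨u, v, huv⟩ := zip_infix_left b b' hlen hxy
      exact (path_pairs_adj2 c _ _ _ ((huv.trans h).trans hds) hcxy).1
    · obtain ⟨u, v, huv⟩ := zip_infix_right b' b hlen.symm hxy
      have hi := (huv.trans h).trans hds
      have h1 := pairsL_ne c (k + 1) L hL (u, x) (hi.subset (by simp))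
      have h2 := pairsL_ne c (k + 1) L hL (v, y) (hi.subset (by simp))
      refine (path_pairs_adj2 c _ _ _ hi ?_).2
      simp only at h1 h2 ⊢
      rw [← hcxy] at h2
      revert h1 h2
      cases c u <;> cases c v <;> cases c x <;> simp
    · exact (ih' _ h x y (hxy.trans (List.prefix_append _ _).isInfix)).mono hss
    · refine ((ih' _ h y x ?_).mono hss).symm
      have : [y, x] <:+: b.reverse := by
        have := List.reverse_infix.2 hxy
        simpa using this
      exact this.trans (List.suffix_append _ _).isInfix

theorem types_lemma (c₁ c₂ : V → Bool) : ∀ L : List (List V),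
    (dsL c₁ L = dsL c₂ L ∧ ssL c₁ L = ssL c₂ L) ∨
    ∃ b ∈ L, ∃ b' ∈ L, (List.zip b b' <:+: dsL c₁ L ∧ b ++ b'.reverse ∈ ssL c₂ L) ∨
      (List.zip b b' <:+: dsL c₂ L ∧ b ++ b'.reverse ∈ ssL c₁ L)
  | [] => by simp [dsL, ssL]
  | [_] => by simp [dsL, ssL]
  | b :: b' :: r => by
    have p (c : V → Bool) := (List.prefix_append (List.zip b b') (dsL c r)).isInfix
    have q (c : V → Bool) := (List.suffix_append (List.zip b b') (dsL c r)).isInfix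
    by_cases e₁ : hcol c₁ b = hcol c₁ b' <;> by_cases e₂ : hcol c₂ b = hcol c₂ b'
    · simp only [dsL, ssL, if_pos e₁, if_pos e₂]
      rcases types_lemma c₁ c₂ r with ⟨h, h'⟩ | ⟨d, hd, d', hd', h⟩
      · left; simp [h, h']
      · right
        refine ⟨d, by simp [hd], d', by simp [hd'], h.imp ?_ ?_⟩ <;>
          exact fun h => ⟨h.1, by simp [h.2]⟩
    · simp only [dsL, ssL, if_pos e₁, if_neg e₂]
      exact Or.inr ⟨b, by simp, b', by simp, Or.inr ⟨p _, by simp⟩⟩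
    · simp only [dsL, ssL, if_neg e₁, if_pos e₂]
      exact Or.inr ⟨b, by simp, b', by simp, Or.inl ⟨p _, by simp⟩⟩
    · simp only [dsL, ssL, if_neg e₁, if_neg e₂]
      rcases types_lemma c₁ c₂ r with ⟨h, h'⟩ | ⟨d, hd, d', hd', h⟩
      · left; simp [h, h']
      · right
        refine ⟨d, by simp [hd], d', by simp [hd'], h.imp ?_ ?_⟩ <;>
          exact fun h => ⟨h.1.trans (q _), h.2⟩

theorem ds_cons_infix (c : V → Bool) (b b' : List V) (r : List (List V)) :
    dsL c r <:+: dsL c (b :: b' :: r) := by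
  simp only [dsL]
  split
  · exact List.infix_rfl
  · exact (List.suffix_append _ _).isInfix

theorem ss_cons_mem (c : V → Bool) (b b' : List V) (r : List (List V)) (s : List V)
    (h : s ∈ ssL c r) : s ∈ ssL c (b :: b' :: r) := by
  simp only [ssL]
  split
  · simp [h]
  · exact h

theorem ss_tail (c : V → Bool) (b b' : List V) (r : List (List V)) (s : List V)
    (h : s ∈ (ssL c (b :: b' :: r)).tail) : s ∈ ssL c r := by
  simp only [ssL] at h
  split at h
  · simpa using h
  · exact List.mem_of_mem_tail h

/-- from a pair of blocks to a triangle -/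
theorem tri_of_blocks (c₁ c₂ : V → Bool) (k : ℕ) (L : List (List V)) (h₁ : GoodL c₁ L)
    (h₂ : GoodL c₂ L) (hk : L.length ≤ k + 1) (b b' : List V) (hb : b ∈ L) (hb' : b' ∈ L)
    (hz : List.zip b b' <:+: dsL c₁ L) (hs : b ++ b'.reverse ∈ ssL c₂ L) :
    ∃ x ∈ b, ∃ y ∈ b', Adj1 (pathL c₁ (pairsL c₁ (k + 1) L)) x y ∧
      Adj2 (pathL c₂ (pairsL c₂ (k + 1) L)) x y := by
  obtain ⟨m, hm, hw⟩ := h₁.wf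
  have hpos : 0 < L.length := List.length_pos_of_mem hb
  have hsl := ssL_len c₂ L
  rcases List.eq_nil_or_concat b with rfl | ⟨s, x, rfl⟩
  · have := hw _ hb; simp at this; omega
  rcases List.eq_nil_or_concat b' with rfl | ⟨s', y, rfl⟩
  · have := hw _ hb'; simp at this; omega
  have hl : s.length = s'.length := by
    have := (hw _ hb).trans (hw _ hb').symm
    simpa using this
  refine ⟨x, by simp, y, by simp, ?_, ?_⟩
  · refine pathL_mem_infix c₁ _ (x, y) ((pairsL_ds c₁ k L).subset (hz.subset ?_))
    simp only [List.concat_eq_append]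
    rw [List.zip_append hl]
    simp
  · refine (adj2_of_block c₂ k (ssL c₂ L) h₂.ss (by omega) _ hs x y ?_).mono
      (pathL_infix (pairsL_ss c₂ k L))
    exact ⟨s, s'.reverse, by simp⟩

theorem pairs_lemma (c₁ c₂ : V → Bool) (ph : V) (k : ℕ) : ∀ L : List (List V), GoodL c₁ L →
    GoodL c₂ L → L.length ≤ k → (∀ b ∈ L.tail, ph ∉ b) →
    pairsL c₁ k L = pairsL c₂ k L ∨ ∃ x y, x ≠ ph ∧ y ≠ ph ∧
      ((Adj1 (pathL c₁ (pairsL c₁ k L)) x y ∧ Adj2 (pathL c₂ (pairsL c₂ k L)) x y) ∨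
       (Adj1 (pathL c₂ (pairsL c₂ k L)) x y ∧ Adj2 (pathL c₁ (pairsL c₁ k L)) x y)) := by
  induction k with
  | zero => intro L _ _ _ _; left; rfl
  | succ k ih =>
    intro L h₁ h₂ hk hph
    match L, h₁, h₂, hk, hph with
    | [], h₁, h₂, hk, hph =>
      rcases ih [] h₁ h₂ (by simp) (by simp) with h | ⟨x, y, hx, hy, h⟩
      · left; simp [pairsL, headSame, dsL, ssL, h]
      · right; refine ⟨x, y, hx, hy, ?_⟩; simpa [pairsL, headSame, dsL, ssL] using h
    | [d], h₁, h₂, hk, hph => have := h₁.even; simp at this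
    | d :: d' :: r, h₁, h₂, hk, hph =>
      rcases types_lemma c₁ c₂ r with ⟨hd, hs⟩ | ⟨b, hb, b', hb', h⟩
      · have e₁ := h₁.ss.even
        have e₂ := h₂.ss.even
        have same : hcol c₁ d = hcol c₁ d' ↔ hcol c₂ d = hcol c₂ d' := by
          simp only [ssL] at e₁ e₂
          rw [hs] at e₁
          by_cases a : hcol c₁ d = hcol c₁ d' <;> by_cases b : hcol c₂ d = hcol c₂ d' <;>
            simp only [a, b, if_true, if_false, List.length_cons] at e₁ e₂ ⊢ <;> omega
        have hd' : dsL c₁ (d :: d' :: r) = dsL c₂ (d :: d' :: r) := by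
          simp only [dsL, same, hd]
        have hs' : ssL c₁ (d :: d' :: r) = ssL c₂ (d :: d' :: r) := by
          simp only [ssL, same, hs]
        have hh' : headSame c₁ (d :: d' :: r) = headSame c₂ (d :: d' :: r) := by
          rw [Bool.eq_iff_iff]
          simpa only [headSame, beq_iff_eq] using same
        have hl := ssL_len c₁ (d :: d' :: r)
        have hp' : ∀ b ∈ (ssL c₁ (d :: d' :: r)).tail, ph ∉ b := by
          intro s hs
          obtain ⟨b, hb, b', hb', _, rfl⟩ := ssL_mem c₁ r s (ss_tail c₁ d d' r s hs)
          have q := hph b (by simp [hb])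
          have q' := hph b' (by simp [hb'])
          simp [q, q']
        rcases ih (ssL c₁ (d :: d' :: r)) h₁.ss (hs' ▸ h₂.ss) (by simp at hk hl ⊢; omega) hp'
          with h | ⟨x, y, hx, hy, h⟩
        · left
          simp only [pairsL, hd', hh']
          rw [h, hs']
        · right
          refine ⟨x, y, hx, hy, ?_⟩
          have i₁ := pathL_infix (c := c₁) (pairsL_ss c₁ k (d :: d' :: r))
          have i₂ := pathL_infix (c := c₂) (pairsL_ss c₂ k (d :: d' :: r))
          rw [← hs'] at i₂
          exact h.imp (fun h => ⟨h.1.mono i₁, h.2.mono i₂⟩) (fun h => ⟨h.1.mono i₂, h.2.mono i₁⟩)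
      · right
        have hpb : ∀ z ∈ b, z ≠ ph := fun z hz e => hph b (by simp [hb]) (e ▸ hz)
        have hpb' : ∀ z ∈ b', z ≠ ph := fun z hz e => hph b' (by simp [hb']) (e ▸ hz)
        rcases h with ⟨hz, hs⟩ | ⟨hz, hs⟩
        · obtain ⟨x, hx, y, hy, h⟩ := tri_of_blocks c₁ c₂ k _ h₁ h₂ hk b b' (by simp [hb])
            (by simp [hb']) (hz.trans (ds_cons_infix _ d d' r)) (ss_cons_mem _ d d' r _ hs)
          exact ⟨x, y, hpb x hx, hpb' y hy, Or.inl h⟩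
        · obtain ⟨x, hx, y, hy, h⟩ := tri_of_blocks c₂ c₁ k _ h₂ h₁ hk b b' (by simp [hb])
            (by simp [hb']) (hz.trans (ds_cons_infix _ d d' r)) (ss_cons_mem _ d d' r _ hs)
          exact ⟨x, y, hpb x hx, hpb' y hy, Or.inr h⟩

theorem orient_lemma (c₁ c₂ : V → Bool) : ∀ (R : List (V × V)) (q : V × V), c₁ q.1 = c₂ q.1 →
    (∀ p ∈ R, c₁ p.1 = c₂ p.1) ∨
    ∃ p z w, [p, z, w] <:+: (pathL c₁ (q :: R)).tail ∧ [p, w, z] <:+: (pathL c₂ (q :: R)).tail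
  | [], q, h => by simp
  | r :: R, q, h => by
    by_cases e : c₁ r.1 = c₂ r.1
    · rcases orient_lemma c₁ c₂ R r e with h' | ⟨p, z, w, h₁, h₂⟩
      · left
        intro p hp
        rcases List.mem_cons.1 hp with rfl | hp
        · exact e
        · exact h' p hp
      · right
        have key (c : V → Bool) : (pathL c (r :: R)).tail <:+: (pathL c (q :: r :: R)).tail := by
          refine (List.tail_suffix _).isInfix.trans ?_
          have e : pathL c (q :: r :: R) =
              (if c q.1 then [q.1, q.2] else [q.2, q.1]) ++ pathL c (r :: R) := rfl
          rw [e]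
          split
          · exact ⟨[q.2], [], by simp⟩
          · exact ⟨[q.1], [], by simp⟩
        exact ⟨p, z, w, h₁.trans (key _), h₂.trans (key _)⟩
    · right
      simp only [pathL]
      rw [h]
      have e' : c₁ r.1 = !c₂ r.1 := by
        revert e; cases c₁ r.1 <;> cases c₂ r.1 <;> simp
      rw [e']
      cases c₂ q.1 <;> cases c₂ r.1
      · exact ⟨q.1, r.1, r.2, ⟨[], pathL c₁ R, by simp⟩, ⟨[], pathL c₂ R, by simp⟩⟩
      · exact ⟨q.1, r.2, r.1, ⟨[], pathL c₁ R, by simp⟩, ⟨[], pathL c₂ R, by simp⟩⟩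
      · exact ⟨q.2, r.1, r.2, ⟨[], pathL c₁ R, by simp⟩, ⟨[], pathL c₂ R, by simp⟩⟩
      · exact ⟨q.2, r.2, r.1, ⟨[], pathL c₁ R, by simp⟩, ⟨[], pathL c₂ R, by simp⟩⟩

theorem pathL_zip_perm (c : V → Bool) : ∀ b b' : List V, b.length = b'.length →
    (pathL c (List.zip b b')).Perm (b ++ b')
  | [], [], _ => by simp [pathL]
  | [], _ :: _, h => by simp at h
  | _ :: _, [], h => by simp at h
  | x :: b, y :: b', h => by
    have ih := pathL_zip_perm c b b' (by simpa using h)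
    simp only [List.zip_cons_cons, pathL]
    have : (x :: y :: pathL c (List.zip b b')).Perm (x :: b ++ y :: b') := by
      refine List.Perm.cons x ?_
      exact (List.Perm.cons y ih).trans List.perm_middle.symm
    split
    · exact this
    · exact (List.Perm.swap _ _ _).trans this

theorem step_perm (c : V → Bool) : ∀ L : List (List V), L.length % 2 = 0 →
    (∃ m, ∀ b ∈ L, b.length = m) → ((ssL c L).flatten ++ pathL c (dsL c L)).Perm L.flatten
  | [], _, _ => by simp [ssL, dsL, pathL]
  | [_], h, _ => by simp at h
  | b :: b' :: r, h, ⟨m, hm⟩ => by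
    have ih := step_perm c r (by simp at h; omega) ⟨m, fun x hx => hm x (by simp [hx])⟩
    simp only [ssL, dsL]
    split
    · simp only [List.flatten_cons, List.append_assoc]
      exact List.Perm.append_left _ (List.Perm.append (List.reverse_perm _) ih)
    · rw [pathL_append]
      have hz := pathL_zip_perm c b b' (by rw [hm b (by simp), hm b' (by simp)])
      simp only [List.flatten_cons]
      rw [← List.append_assoc b]
      refine List.Perm.trans ?_ (hz.append ih)
      rw [← List.append_assoc, ← List.append_assoc]
      exact List.Perm.append_right _ List.perm_append_comm

theorem pairsL_perm (c : V → Bool) (k : ℕ) : ∀ L : List (List V), GoodL c L → L.length ≤ k →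
    (pathL c (pairsL c k L)).Perm L.flatten := by
  induction k with
  | zero =>
    intro L _ hk
    have : L = [] := List.length_eq_zero_iff.1 (by omega)
    simp [this, pairsL, pathL]
  | succ k ih =>
    intro L hL hk
    have hl := ssL_len c L
    have h1 := ih _ hL.ss (by omega)
    obtain ⟨m, _, hm⟩ := hL.wf
    have h2 := step_perm c L hL.even ⟨m, hm⟩
    simp only [pairsL]
    split
    · rw [pathL_append]
      exact (h1.append_right _).trans h2
    · rw [pathL_append]
      exact List.perm_append_comm.trans ((h1.append_right _).trans h2)

theorem pairsL_head (c : V → Bool) (ph : V) (k : ℕ) : ∀ (t : List V) (L : List (List V)),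
    GoodL c ((ph :: t) :: L) → L.length + 1 ≤ k →
    ∃ y R, pairsL c k ((ph :: t) :: L) = (ph, y) :: R := by
  induction k with
  | zero => intro t L _ hk; omega
  | succ k ih =>
    intro t L hL hk
    match L, hL, hk with
    | [], hL, _ => have := hL.even; simp at this
    | b :: r, hL, hk =>
      by_cases e : hcol c (ph :: t) = hcol c b
      · have hss := hL.ss
        simp only [pairsL, headSame, e, beq_self_eq_true, if_true]
        simp only [ssL, e, if_true, List.cons_append] at hss ⊢
        have hl := ssL_len c r
        obtain ⟨y, R, h⟩ := ih _ _ hss (by simp at hk; omega)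
        exact ⟨y, R ++ _, by rw [h]; simp; rfl⟩
      · obtain ⟨m, hm, hw⟩ := hL.wf
        match b, e, hw with
        | [], _, hw => have := hw [] (by simp); simp at this; omega
        | y :: b, e, hw =>
          have : headSame c ((ph :: t) :: (y :: b) :: r) = false := by
            simpa [headSame] using e
          simp only [pairsL, this, dsL, if_neg e]
          exact ⟨y, _, by simp; rfl⟩

def mkPath (c : V → Bool) (l : List V) : List V :=
  pathL c (pairsL c l.length (l.map fun x => [x]))

theorem balL_single (c : V → Bool) (l : List V) :
    balL c (l.map fun x => [x]) = 2 * (l.countP c : ℤ) - l.length := by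
  induction l with
  | nil => rfl
  | cons x l ih =>
    simp only [List.map_cons, balL, ih, hcol, List.countP_cons, List.length_cons]
    push_cast
    by_cases hx : c x = true
    · simp only [hx, if_true]; ring
    · simp only [hx]; simp; ring

theorem good_single (c : V → Bool) (l : List V) (h : 2 * l.countP c = l.length) :
    GoodL c (l.map fun x => [x]) := by
  refine ⟨⟨1, by simp, by simp⟩, by simp [hcol], ?_⟩
  rw [balL_single]; omega

theorem mkPath_perm (c : V → Bool) (l : List V) (h : 2 * l.countP c = l.length) :
    (mkPath c l).Perm l := by
  have := pairsL_perm c l.length _ (good_single c l h) (by simp)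
  have e : (l.map fun x => [x]).flatten = l := by
    clear this h
    induction l with
    | nil => rfl
    | cons x l ih => simp [ih]
  rw [e] at this
  exact this

theorem mkPath_main (c₁ c₂ : V → Bool) (ph : V) (l : List V) (hnd : (ph :: l).Nodup)
    (h₁ : 2 * (ph :: l).countP c₁ = (ph :: l).length)
    (h₂ : 2 * (ph :: l).countP c₂ = (ph :: l).length) (e₁ : c₁ ph = true) (e₂ : c₂ ph = true) :
    (∀ v ∈ l, c₁ v = c₂ v) ∨ ∃ x y z, x ≠ ph ∧ y ≠ ph ∧ z ≠ ph ∧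
      ∀ q, (q = (x, y) ∨ q = (y, z) ∨ q = (x, z)) →
        Adj1 (mkPath c₁ (ph :: l)) q.1 q.2 ∨ Adj1 (mkPath c₂ (ph :: l)) q.1 q.2 := by
  have g₁ := good_single c₁ _ h₁
  have g₂ := good_single c₂ _ h₂
  have p₁ := mkPath_perm c₁ _ h₁
  have p₂ := mkPath_perm c₂ _ h₂
  have n₁ := p₁.nodup_iff.2 hnd
  have n₂ := p₂.nodup_iff.2 hnd
  obtain ⟨y₁, R₁, k₁⟩ := pairsL_head c₁ ph (ph :: l).length [] (l.map fun x => [x]) g₁ (by simp)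
  obtain ⟨y₂, R₂, k₂⟩ := pairsL_head c₂ ph (ph :: l).length [] (l.map fun x => [x]) g₂ (by simp)
  have t₁ : ∃ t, mkPath c₁ (ph :: l) = ph :: t := by
    simp only [mkPath, List.map_cons]; rw [k₁]; simp [pathL, e₁]
  have t₂ : ∃ t, mkPath c₂ (ph :: l) = ph :: t := by
    simp only [mkPath, List.map_cons]; rw [k₂]; simp [pathL, e₂]
  -- the middle vertex is never the head
  have mid : ∀ (P : List V), P.Nodup → (∃ t, P = ph :: t) → ∀ x y z, [x, z, y] <:+: P →
      z ≠ ph := by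
    rintro P hP ⟨t, rfl⟩ x y z ⟨s, r, h⟩ rfl
    cases s with
    | nil =>
      simp at h
      obtain ⟨rfl, h⟩ := h
      simp [← h] at hP
    | cons a s =>
      simp at h
      obtain ⟨rfl, h⟩ := h
      simp [← h] at hP
  have fin : ∀ P Q : List V, P.Nodup → (∃ t, P = ph :: t) → ∀ x y, x ≠ ph → y ≠ ph →
      Adj1 Q x y → Adj2 P x y → ∃ x y z, x ≠ ph ∧ y ≠ ph ∧ z ≠ ph ∧
      ∀ q, (q = (x, y) ∨ q = (y, z) ∨ q = (x, z)) → Adj1 Q q.1 q.2 ∨ Adj1 P q.1 q.2 := by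
    rintro P Q hP ht x y hx hy hQ ⟨z, hz⟩
    refine ⟨x, y, z, hx, hy, ?_, ?_⟩
    · rcases hz with hz | hz
      · exact mid P hP ht _ _ _ hz
      · exact mid P hP ht _ _ _ hz
    · have i₁ (a b c : V) : [a, b] <:+: [a, b, c] := ⟨[], [c], by simp⟩
      have i₂ (a b c : V) : [b, c] <:+: [a, b, c] := ⟨[a], [], by simp⟩
      rintro q (rfl | rfl | rfl)
      · exact Or.inl hQ
      · right
        rcases hz with hz | hz
        · exact Or.inr ((i₂ _ _ _).trans hz)
        · exact Or.inl ((i₁ _ _ _).trans hz)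
      · right
        rcases hz with hz | hz
        · exact Or.inl ((i₁ _ _ _).trans hz)
        · exact Or.inr ((i₂ _ _ _).trans hz)
  have hph : ∀ b ∈ ((ph :: l).map fun x => [x]).tail, ph ∉ b := by
    intro b hb
    simp at hb
    obtain ⟨a, ha, rfl⟩ := hb
    simp only [List.mem_singleton]
    rintro rfl
    simp [ha] at hnd
  rcases pairs_lemma c₁ c₂ ph (ph :: l).length _ g₁ g₂ (by simp) hph with h | ⟨x, y, hx, hy, h⟩
  · have hk := h
    simp only [List.map_cons] at hk
    rw [k₁] at hk
    have k₂' := k₂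
    rw [← hk] at k₂'
    have m₁ : mkPath c₁ (ph :: l) = pathL c₁ ((ph, y₁) :: R₁) := by
      simp only [mkPath, List.map_cons]; rw [k₁]
    have m₂ : mkPath c₂ (ph :: l) = pathL c₂ ((ph, y₁) :: R₁) := by
      simp only [mkPath, List.map_cons]; rw [← hk]
    rcases orient_lemma c₁ c₂ R₁ (ph, y₁) (by simp [e₁, e₂]) with h' | ⟨p, z, w, a, b⟩
    · left
      have b₁ := pairsL_ne c₁ (ph :: l).length _ g₁
      have b₂ := pairsL_ne c₂ (ph :: l).length _ g₂
      simp only [List.map_cons] at b₁ b₂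
      rw [k₁] at b₁
      rw [← hk] at b₂
      have all : ∀ p ∈ (ph, y₁) :: R₁, c₁ p.1 = c₂ p.1 ∧ c₁ p.2 = c₂ p.2 := by
        intro p hp
        have q₁ := b₁ p hp
        have q₂ := b₂ p hp
        have q : c₁ p.1 = c₂ p.1 := by
          rcases List.mem_cons.1 hp with rfl | hp
          · simp [e₁, e₂]
          · exact h' p hp
        refine ⟨q, ?_⟩
        rw [q] at q₁
        revert q₁ q₂
        cases c₂ p.1 <;> cases c₁ p.2 <;> cases c₂ p.2 <;> simp
      have mem : ∀ (R : List (V × V)) v, v ∈ pathL c₁ R → ∃ p ∈ R, v = p.1 ∨ v = p.2 := by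
        intro R v
        induction R with
        | nil => simp [pathL]
        | cons p R ih =>
          intro hv
          simp only [pathL, List.mem_append] at hv
          rcases hv with hv | hv
          · refine ⟨p, by simp, ?_⟩
            split at hv <;> simp at hv <;> tauto
          · obtain ⟨p', hp', h⟩ := ih hv
            exact ⟨p', by simp [hp'], h⟩
      intro v hv
      have : v ∈ mkPath c₁ (ph :: l) := p₁.mem_iff.2 (by simp [hv])
      rw [m₁] at this
      obtain ⟨p, hp, rfl | rfl⟩ := mem _ _ this
      · exact (all p hp).1
      · exact (all p hp).2
    · right
      rw [← m₁] at a
      rw [← m₂] at b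
      have ne : ∀ v ∈ [p, z, w], v ≠ ph := by
        intro v hv
        obtain ⟨t, ht⟩ := t₁
        rw [ht] at n₁ a
        rintro rfl
        exact (List.nodup_cons.1 n₁).1 (a.subset hv)
      have a' := a.trans (List.tail_suffix _).isInfix
      have b' := b.trans (List.tail_suffix _).isInfix
      refine ⟨p, z, w, ne p (by simp), ne z (by simp), ne w (by simp), ?_⟩
      rintro q (rfl | rfl | rfl)
      · exact Or.inl (Or.inl (List.IsInfix.trans ⟨[], [w], by simp⟩ a'))
      · exact Or.inl (Or.inl (List.IsInfix.trans ⟨[p], [], by simp⟩ a'))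
      · exact Or.inr (Or.inl (List.IsInfix.trans ⟨[], [z], by simp⟩ b'))
  · right
    rcases h with h | h
    · exact fin _ _ n₂ t₂ x y hx hy h.1 h.2
    · obtain ⟨x, y, z, a, b, c, h⟩ := fin _ _ n₁ t₁ x y hx hy h.1 h.2
      exact ⟨x, y, z, a, b, c, fun q hq => (h q hq).symm⟩

end Core

section Final

theorem cycle3_iff {V : Type*} (G : SimpleGraph V) :
    ContainsCycleLen G 3 ↔ ∃ x y z, G.Adj x y ∧ G.Adj y z ∧ G.Adj x z := by
  classical
  unfold ContainsCycleLen
  rw [← is3Clique_iff_exists_cycle_length_three]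
  constructor
  · rintro ⟨s, hs⟩
    obtain ⟨a, b, c, h1, h2, h3, _⟩ := is3Clique_iff.1 hs
    exact ⟨a, b, c, h1, h3, h2⟩
  · rintro ⟨a, b, c, h1, h2, h3⟩
    exact ⟨{a, b, c}, is3Clique_iff.2 ⟨a, b, c, h1, h3, h2, rfl⟩⟩

theorem no_tri_of_col {V : Type*} (G : SimpleGraph V) (A : Set V)
    (h : ∀ a b, G.Adj a b → (a ∈ A ↔ b ∉ A)) : ¬ ContainsCycleLen G 3 := by
  rw [cycle3_iff]
  rintro ⟨x, y, z, h1, h2, h3⟩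
  have := h _ _ h1
  have := h _ _ h2
  have := h _ _ h3
  tauto

theorem ham_col {n : ℕ} (G : SimpleGraph (Fin n)) (h : IsHamPathGraph G) :
    ∃ A : Finset (Fin n), A.card = n / 2 ∧ ∀ a b, G.Adj a b → (a ∈ A ↔ b ∉ A) := by
  obtain ⟨σ, hσ⟩ := h
  refine ⟨Finset.univ.filter fun a => (σ a).val % 2 = 1, ?_, ?_⟩
  · have h1 : (Finset.univ.filter fun a => (σ a).val % 2 = 1).card =
        ((Finset.range n).filter fun i => i % 2 = 1).card := by
      refine Finset.card_bij (fun a _ => (σ a).val) ?_ ?_ ?_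
      · intro a ha; simpa using ha
      · intro a _ b _ hab
        exact σ.injective (Fin.ext hab)
      · intro i hi
        simp at hi
        exact ⟨σ.symm ⟨i, hi.1⟩, by simp [hi.2], by simp⟩
    rw [h1]
    clear h1 hσ σ G
    induction n with
    | zero => rfl
    | succ n ih =>
      rw [Finset.range_add_one, Finset.filter_insert]
      split
      · rw [Finset.card_insert_of_notMem (by simp), ih]; omega
      · rw [ih]; omega
  · intro a b hab
    rw [hσ, pathGraph_adj] at hab
    simp
    omega

theorem ham_no_tri {n : ℕ} (G : SimpleGraph (Fin n)) (h : IsHamPathGraph G) :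
    ¬ ContainsCycleLen G 3 := by
  obtain ⟨A, _, hA⟩ := ham_col G h
  exact no_tri_of_col G (A : Set (Fin n)) (by simpa using hA)

theorem ham_of_list {n : ℕ} (l : List (Fin n)) (hnd : l.Nodup) (hm : ∀ a, a ∈ l) :
    ∃ G : SimpleGraph (Fin n), IsHamPathGraph G ∧ ∀ a b, Adj1 l a b → G.Adj a b := by
  have hlen : l.length = n := by
    have := List.toFinset_card_of_nodup hnd
    have e : l.toFinset = Finset.univ := by ext; simp [hm]
    rw [e] at this
    simpa using this.symm
  let f : Fin n → Fin n := fun a => ⟨l.idxOf a, lt_of_lt_of_eq (List.idxOf_lt_length_iff.2 (hm a)) hlen⟩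
  have hf : Function.Injective f := by
    intro a b h
    have h' : l.idxOf a = l.idxOf b := congrArg Fin.val h
    exact (List.idxOf_inj (hm a)).1 h'
  let σ : Equiv.Perm (Fin n) := Equiv.ofBijective f (Finite.injective_iff_bijective.1 hf)
  refine ⟨(pathGraph n).comap σ, ⟨σ, fun a b => Iff.rfl⟩, ?_⟩
  have key : ∀ a b, [a, b] <:+: l → l.idxOf a + 1 = l.idxOf b := by
    rintro a b ⟨s, t, rfl⟩
    rw [List.append_assoc, List.nodup_append] at hnd
    obtain ⟨_, h2, h3⟩ := hnd
    have ha : a ∉ s := fun h => h3 a h a (by simp) rfl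
    have hb : b ∉ s := fun h => h3 b h b (by simp) rfl
    have hab : a ≠ b := by rintro rfl; simp at h2
    rw [List.append_assoc, List.idxOf_append_of_notMem ha, List.idxOf_append_of_notMem hb]
    simp [hab]
  intro a b h
  rw [comap_adj, pathGraph_adj]
  exact h.imp (key a b) (key b a)

theorem Hnum_bdd (n k : ℕ) : BddAbove {m | ∃ F : Finset (SimpleGraph (Fin n)), F.card = m ∧
    (∀ G ∈ F, IsHamPathGraph G) ∧
    ∀ G₁ ∈ F, ∀ G₂ ∈ F, G₁ ≠ G₂ → ContainsCycleLen (G₁ ⊔ G₂) k} := by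
  classical
  refine ⟨Fintype.card (SimpleGraph (Fin n)), ?_⟩
  rintro m ⟨F, rfl, _⟩
  exact Finset.card_le_univ F

theorem lower {n : ℕ} {ι : Type*} (s : Finset ι) (l : ι → List (Fin n))
    (hnd : ∀ i ∈ s, (l i).Nodup) (hm : ∀ i ∈ s, ∀ a, a ∈ l i)
    (ht : ∀ i ∈ s, ∀ j ∈ s, i ≠ j → ∃ x y z, ∀ q, (q = (x, y) ∨ q = (y, z) ∨ q = (x, z)) →
        Adj1 (l i) q.1 q.2 ∨ Adj1 (l j) q.1 q.2) : s.card ≤ Hnum n 3 := by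
  classical
  choose! G hG hA using fun i (hi : i ∈ s) => ham_of_list (l i) (hnd i hi) (hm i hi)
  have tri : ∀ i ∈ s, ∀ j ∈ s, i ≠ j → ContainsCycleLen (G i ⊔ G j) 3 := by
    intro i hi j hj hij
    obtain ⟨x, y, z, h⟩ := ht i hi j hj hij
    rw [cycle3_iff]
    refine ⟨x, y, z, ?_, ?_, ?_⟩
    · exact (h (x, y) (by simp)).imp (hA i hi _ _) (hA j hj _ _)
    · exact (h (y, z) (by simp)).imp (hA i hi _ _) (hA j hj _ _)
    · exact (h (x, z) (by simp)).imp (hA i hi _ _) (hA j hj _ _)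
  refine le_csSup (Hnum_bdd n 3) ⟨s.image G, ?_, ?_, ?_⟩
  · apply Finset.card_image_of_injOn
    intro i hi j hj h
    by_contra hij
    have := tri i hi j hj hij
    rw [← h, sup_idem] at this
    exact ham_no_tri _ (hG i hi) this
  · intro g hg
    obtain ⟨i, hi, rfl⟩ := Finset.mem_image.1 hg
    exact hG i hi
  · intro g hg g' hg' hne
    obtain ⟨i, hi, rfl⟩ := Finset.mem_image.1 hg
    obtain ⟨j, hj, rfl⟩ := Finset.mem_image.1 hg'
    exact tri i hi j hj (fun h => hne (by rw [h]))

theorem Hnum_le (n b : ℕ) (h : ∀ F : Finset (SimpleGraph (Fin n)),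
    (∀ G ∈ F, IsHamPathGraph G) →
    (∀ G₁ ∈ F, ∀ G₂ ∈ F, G₁ ≠ G₂ → ContainsCycleLen (G₁ ⊔ G₂) 3) → F.card ≤ b) :
    Hnum n 3 ≤ b := by
  refine csSup_le ⟨0, ∅, by simp⟩ ?_
  rintro m ⟨F, rfl, h1, h2⟩
  exact h F h1 h2

theorem upper_odd (n : ℕ) : Hnum n 3 ≤ n.choose (n / 2) := by
  classical
  refine Hnum_le n _ fun F h1 h2 => ?_
  choose! A hA hc using fun G (hG : G ∈ F) => ham_col G (h1 G hG)
  have : F.card ≤ (Finset.powersetCard (n / 2) (Finset.univ : Finset (Fin n))).card := by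
    refine Finset.card_le_card_of_injOn A ?_ ?_
    · intro G hG
      simp [Finset.mem_powersetCard, hA G hG]
    · intro G hG G' hG' e
      by_contra hne
      refine no_tri_of_col _ (A G : Set (Fin n)) ?_ (h2 G hG G' hG' hne)
      rintro a b (h | h)
      · simpa using hc G hG a b h
      · simpa [e] using hc G' hG' a b h
  simpa using this

theorem upper_even (n : ℕ) (hn : 0 < n) (he : Even n) : 2 * Hnum n 3 ≤ n.choose (n / 2) := by
  classical
  suffices Hnum n 3 ≤ n.choose (n / 2) / 2 by omega
  refine Hnum_le n _ fun F h1 h2 => ?_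
  choose! A hA hc using fun G (hG : G ∈ F) => ham_col G (h1 G hG)
  have : (F ×ˢ (Finset.univ : Finset Bool)).card ≤
      (Finset.powersetCard (n / 2) (Finset.univ : Finset (Fin n))).card := by
    refine Finset.card_le_card_of_injOn (fun p => if p.2 then A p.1 else (A p.1)ᶜ) ?_ ?_
    · rintro ⟨G, b⟩ hG
      simp at hG
      obtain ⟨k, rfl⟩ := he
      cases b
      · simp [Finset.mem_powersetCard, Finset.card_compl, hA G hG]
        omega
      · simp [Finset.mem_powersetCard, hA G hG]
    · rintro ⟨G, b⟩ hG ⟨G', b'⟩ hG' e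
      simp at hG hG'
      have e' : (∀ a, a ∈ A G ↔ a ∈ A G') ∧ b = b' ∨ (∀ a, a ∈ A G ↔ a ∉ A G') ∧ b ≠ b' := by
        have e2 := fun a => Finset.ext_iff.1 e a
        cases b <;> cases b' <;> simp at e2 ⊢
        · intro a; have := e2 a; tauto
        · intro a; have := e2 a; tauto
        · exact e2
        · exact e2
      have hGG : G = G' := by
        by_contra hne
        refine no_tri_of_col _ (A G : Set (Fin n)) ?_ (h2 G hG G' hG' hne)
        rintro a b (h | h)
        · simpa using hc G hG a b h
        · have hh := hc G' hG' a b h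
          simp only [Finset.mem_coe]
          rcases e' with ⟨e', _⟩ | ⟨e', _⟩
          · rw [e', e']; exact hh
          · rw [e', e']; tauto
      subst hGG
      rcases e' with ⟨_, e'⟩ | ⟨e', _⟩
      · rw [e']
      · have := e' ⟨0, hn⟩
        tauto
  simp at this
  omega

/-- colouring of `Option (Fin m)` -/
def optCol {m : ℕ} (A : Finset (Fin m)) : Option (Fin m) → Bool
  | none => true
  | some a => decide (a ∈ A)

def optList (m : ℕ) : List (Option (Fin m)) := (List.finRange m).map some

theorem optCol_count {m : ℕ} (hm : Odd m) (A : Finset (Fin m)) (hA : A.card = m / 2) :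
    2 * (none :: optList m).countP (optCol A) = (none :: optList m).length := by
  have : (List.finRange m).countP (fun a => decide (a ∈ A)) = A.card := by
    rw [List.countP_eq_length_filter, ← List.toFinset_card_of_nodup
      ((List.nodup_finRange m).filter _)]
    congr 1
    ext a; simp
  obtain ⟨k, rfl⟩ := hm
  have e : (optList (2 * k + 1)).countP (optCol A) = A.card := by
    rw [optList, List.countP_map, ← this]; rfl
  rw [List.countP_cons, e, hA]
  simp [optCol, optList]
  omega

theorem optList_nodup (m : ℕ) : (none :: optList m).Nodup := by
  simp [optList, List.nodup_map_iff (Option.some_injective _), List.nodup_finRange]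

theorem opt_main {m : ℕ} (hm : Odd m) (A B : Finset (Fin m)) (hA : A.card = m / 2)
    (hB : B.card = m / 2) (hAB : A ≠ B) : ∃ x y z : Fin m,
      ∀ q : Fin m × Fin m, (q = (x, y) ∨ q = (y, z) ∨ q = (x, z)) →
        Adj1 (mkPath (optCol A) (none :: optList m)) (some q.1) (some q.2) ∨
        Adj1 (mkPath (optCol B) (none :: optList m)) (some q.1) (some q.2) := by
  rcases mkPath_main (optCol A) (optCol B) none (optList m) (optList_nodup m)
    (optCol_count hm A hA) (optCol_count hm B hB) rfl rfl with h | ⟨x, y, z, hx, hy, hz, h⟩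
  · exfalso
    apply hAB
    ext a
    have := h (some a) (by simp [optList])
    simpa [optCol] using this
  · obtain ⟨x, rfl⟩ := Option.ne_none_iff_exists'.1 hx
    obtain ⟨y, rfl⟩ := Option.ne_none_iff_exists'.1 hy
    obtain ⟨z, rfl⟩ := Option.ne_none_iff_exists'.1 hz
    refine ⟨x, y, z, fun q hq => h (some q.1, some q.2) ?_⟩
    rcases hq with rfl | rfl | rfl <;> simp

theorem lower_odd (m : ℕ) (hm : Odd m) : m.choose (m / 2) ≤ Hnum m 3 := by
  have := lower (n := m) (Finset.powersetCard (m / 2) (Finset.univ : Finset (Fin m)))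
    (fun A => (mkPath (optCol A) (none :: optList m)).filterMap id) ?_ ?_ ?_
  · simpa using this
  · intro A hA
    have p := mkPath_perm _ _ (optCol_count hm A (Finset.mem_powersetCard.1 hA).2)
    refine List.Nodup.filterMap ?_ (p.nodup_iff.2 (optList_nodup m))
    intro a a' b h h'
    simp at h h'
    rw [h, h']
  · intro A hA a
    have p := mkPath_perm _ _ (optCol_count hm A (Finset.mem_powersetCard.1 hA).2)
    simp only [List.mem_filterMap]
    exact ⟨some a, p.mem_iff.2 (by simp [optList]), rfl⟩
  · intro A hA B hB hAB
    obtain ⟨x, y, z, h⟩ := opt_main hm A B (Finset.mem_powersetCard.1 hA).2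
      (Finset.mem_powersetCard.1 hB).2 hAB
    refine ⟨x, y, z, fun q hq => ?_⟩
    have key : ∀ (l : List (Option (Fin m))) a b, Adj1 l (some a) (some b) →
        Adj1 (l.filterMap id) a b := by
      intro l a b h
      refine h.imp (fun h => ?_) (fun h => ?_)
      · simpa using h.filterMap id
      · simpa using h.filterMap id
    exact (h q hq).imp (key _ _ _) (key _ _ _)

theorem lower_even (m : ℕ) (hm : Odd m) : m.choose (m / 2) ≤ Hnum (m + 1) 3 := by
  let e : Option (Fin m) ≃ Fin (m + 1) := (finSuccEquiv m).symm
  have := lower (n := m + 1) (Finset.powersetCard (m / 2) (Finset.univ : Finset (Fin m)))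
    (fun A => (mkPath (optCol A) (none :: optList m)).map e) ?_ ?_ ?_
  · simpa using this
  · intro A hA
    have p := mkPath_perm _ _ (optCol_count hm A (Finset.mem_powersetCard.1 hA).2)
    exact (p.nodup_iff.2 (optList_nodup m)).map e.injective
  · intro A hA a
    have p := mkPath_perm _ _ (optCol_count hm A (Finset.mem_powersetCard.1 hA).2)
    refine List.mem_map.2 ⟨e.symm a, p.mem_iff.2 ?_, by simp⟩
    cases e.symm a <;> simp [optList]
  · intro A hA B hB hAB
    obtain ⟨x, y, z, h⟩ := opt_main hm A B (Finset.mem_powersetCard.1 hA).2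
      (Finset.mem_powersetCard.1 hB).2 hAB
    refine ⟨e (some x), e (some y), e (some z), ?_⟩
    have key : ∀ (l : List (Option (Fin m))) a b, Adj1 l a b → Adj1 (l.map e) (e a) (e b) := by
      intro l a b h
      refine h.imp (fun h => ?_) (fun h => ?_)
      · simpa using h.map e
      · simpa using h.map e
    rintro q (rfl | rfl | rfl)
    · exact (h (x, y) (by simp)).imp (key _ _ _) (key _ _ _)
    · exact (h (y, z) (by simp)).imp (key _ _ _) (key _ _ _)
    · exact (h (x, z) (by simp)).imp (key _ _ _) (key _ _ _)

end Final

/-- Kovács–Soltész: the exact value of `H(n,3)` for `n ≥ 3`. -/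
theorem stmt_0 (n : ℕ) (hn : 3 ≤ n) :
    (Odd n → Hnum n 3 = n.choose (n / 2)) ∧
    (Even n → 2 * Hnum n 3 = n.choose (n / 2)) := by
  refine ⟨fun ho => le_antisymm (upper_odd n) (lower_odd n ho), fun he => ?_⟩
  refine le_antisymm (upper_even n (by omega) he) ?_
  obtain ⟨k, rfl⟩ : ∃ k, n = (2 * k + 1) + 1 := by
    obtain ⟨j, rfl⟩ := he
    exact ⟨j - 1, by omega⟩
  have h := lower_even (2 * k + 1) ⟨k, rfl⟩
  have e1 : (2 * k + 1) / 2 = k := by omega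
  have e2 : (2 * k + 1 + 1) / 2 = k + 1 := by omega
  rw [e1] at h
  rw [e2, Nat.choose_succ_succ, Nat.choose_symm_half]
  omega
end

section
/- For every integer ℓ ≥ 1, H(n, 2^ℓ + 1) = 2^{n − o(n)}; precisely, for every ε > 0 there exists N such that for all n ≥ N, 2^{(1−ε)n} ≤ H(n, 2^ℓ + 1) ≤ 2^{(1+ε)n}. -/
open SimpleGraph

/-! ### Lists with prescribed index distances -/

/-- `u` and `v` occur in `L` at index distance `d`. -/
def Near {V : Type} (d : ℕ) (u v : V) (L : List V) : Prop :=
  ∃ i : ℕ, (L[i]? = some u ∧ L[i + d]? = some v) ∨ (L[i]? = some v ∧ L[i + d]? = some u)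

/-- some pair is adjacent in one list and at index distance `M` in the other. -/
def Separated {V : Type} (M : ℕ) (L K : List V) : Prop :=
  ∃ u v : V, (Near 1 u v L ∧ Near M u v K) ∨ (Near M u v L ∧ Near 1 u v K)

/-- the comb `C` (with `r` blocks of width `m`) is realized in `L`. -/
def Rz {V : Type} (M r m : ℕ) (C : ℕ → ℕ → V) (L : List V) : Prop :=
  ∃ q σ τ : ℤ, (σ = 1 ∨ σ = -1) ∧ (τ = 1 ∨ τ = -1) ∧
    ∀ j < r, ∀ s < m, ∃ n : ℕ, (n : ℤ) = q + σ * M * j + τ * s ∧ L[n]? = some (C j s)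

/-- the multiset of elements of a comb. -/
def el {V : Type} (r m : ℕ) (C : ℕ → ℕ → V) : Multiset V :=
  ∑ j ∈ Finset.range r, ∑ s ∈ Finset.range m, ({C j s} : Multiset V)

theorem getElem?_mid {V : Type} (A L B : List V) (i : ℕ) (v : V) (h : L[i]? = some v) :
    (A ++ L ++ B)[A.length + i]? = some v := by
  have hi : i < L.length := by
    by_contra hc
    rw [List.getElem?_eq_none (by omega)] at h
    simp at h
  rw [List.append_assoc, List.getElem?_append_right (by omega), Nat.add_sub_cancel_left,
    List.getElem?_append_left hi, h]

theorem Near.mid {V : Type} {d : ℕ} {u v : V} {L : List V} (h : Near d u v L) (A B : List V) :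
    Near d u v (A ++ L ++ B) := by
  obtain ⟨i, h⟩ := h
  refine ⟨A.length + i, ?_⟩
  rcases h with ⟨h1, h2⟩ | ⟨h1, h2⟩
  · exact Or.inl ⟨getElem?_mid A L B _ _ h1, by rw [add_assoc]; exact getElem?_mid A L B _ _ h2⟩
  · exact Or.inr ⟨getElem?_mid A L B _ _ h1, by rw [add_assoc]; exact getElem?_mid A L B _ _ h2⟩

theorem Separated.mid {V : Type} {M : ℕ} {L L' : List V} (h : Separated M L L') (A B A' B' : List V) :
    Separated M (A ++ L ++ B) (A' ++ L' ++ B') := by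
  obtain ⟨u, v, h⟩ := h
  refine ⟨u, v, ?_⟩
  rcases h with ⟨h1, h2⟩ | ⟨h1, h2⟩
  · exact Or.inl ⟨h1.mid A B, h2.mid A' B'⟩
  · exact Or.inr ⟨h1.mid A B, h2.mid A' B'⟩

theorem Rz.mid {V : Type} {M r m : ℕ} {C : ℕ → ℕ → V} {L : List V} (h : Rz M r m C L)
    (A B : List V) : Rz M r m C (A ++ L ++ B) := by
  obtain ⟨q, σ, τ, hσ, hτ, h⟩ := h
  refine ⟨q + A.length, σ, τ, hσ, hτ, fun j hj s hs => ?_⟩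
  obtain ⟨n, hn, hL⟩ := h j hj s hs
  exact ⟨A.length + n, by push_cast; linarith, getElem?_mid A L B _ _ hL⟩

theorem Near.of_pos {V : Type} {d : ℕ} {u v : V} {L : List V} {a b : ℕ}
    (ha : L[a]? = some u) (hb : L[b]? = some v) (h : (b : ℤ) = a + d ∨ (b : ℤ) = a - d) :
    Near d u v L := by
  rcases h with h | h
  · have : b = a + d := by omega
    subst this
    exact ⟨a, Or.inl ⟨ha, hb⟩⟩
  · have : a = b + d := by omega
    subst this
    exact ⟨b, Or.inr ⟨hb, ha⟩⟩

/-! ### Merging combs -/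

/-- merging two combs into one with twice as many blocks. -/
def mSame {V : Type} (r : ℕ) (U W : ℕ → ℕ → V) : ℕ → ℕ → V :=
  fun j s => if j < r then U (r - 1 - j) s else W (j - r) s

/-- merging two combs into one with blocks of twice the width. -/
def mDiff {V : Type} (m : ℕ) (U W : ℕ → ℕ → V) : ℕ → ℕ → V :=
  fun j s => if s < m then U j s else W j (2 * m - 1 - s)

theorem el_same {V : Type} (r m : ℕ) (U W : ℕ → ℕ → V) :
    el (2 * r) m (mSame r U W) = el r m U + el r m W := by
  unfold el
  rw [two_mul, Finset.sum_range_add]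
  congr 1
  · rw [← Finset.sum_range_reflect]
    refine Finset.sum_congr rfl fun j hj => ?_
    have hj := Finset.mem_range.1 hj
    refine Finset.sum_congr rfl fun s _ => ?_
    unfold mSame
    rw [if_pos (by omega)]
    congr 2; omega
  · refine Finset.sum_congr rfl fun j hj => ?_
    refine Finset.sum_congr rfl fun s _ => ?_
    unfold mSame
    rw [if_neg (by omega)]
    congr 2; omega

theorem el_diff {V : Type} (r m : ℕ) (U W : ℕ → ℕ → V) :
    el r (2 * m) (mDiff m U W) = el r m U + el r m W := by
  unfold el
  rw [← Finset.sum_add_distrib]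
  refine Finset.sum_congr rfl fun j hj => ?_
  rw [two_mul, Finset.sum_range_add]
  congr 1
  · refine Finset.sum_congr rfl fun s hs => ?_
    have hs := Finset.mem_range.1 hs
    unfold mDiff
    rw [if_pos (by omega)]
  · rw [← Finset.sum_range_reflect]
    refine Finset.sum_congr rfl fun s hs => ?_
    have hs := Finset.mem_range.1 hs
    unfold mDiff
    rw [if_neg (by omega)]
    congr 2; omega

theorem Rz.same {V : Type} {M r m : ℕ} {U W : ℕ → ℕ → V} {L : List V} (hr : 1 ≤ r) (hm : 1 ≤ m)
    (h : Rz M (2 * r) m (mSame r U W) L) :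
    Rz M r m U L ∧ Rz M r m W L ∧ Near M (U 0 (m - 1)) (W 0 (m - 1)) L := by
  obtain ⟨q, σ, τ, hσ, hτ, h⟩ := h
  refine ⟨⟨q + σ * M * (r - 1), -σ, τ, by omega, hτ, fun j hj s hs => ?_⟩,
    ⟨q + σ * M * r, σ, τ, hσ, hτ, fun j hj s hs => ?_⟩, ?_⟩
  · obtain ⟨n, hn, hL⟩ := h (r - 1 - j) (by omega) s hs
    refine ⟨n, ?_, ?_⟩
    · have : ((r - 1 - j : ℕ) : ℤ) = r - 1 - j := by omega
      rw [hn, this]; ring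
    · rw [hL]; unfold mSame
      rw [if_pos (by omega)]
      congr 2; omega
  · obtain ⟨n, hn, hL⟩ := h (r + j) (by omega) s hs
    refine ⟨n, ?_, ?_⟩
    · rw [hn]; push_cast; ring
    · rw [hL]; unfold mSame
      rw [if_neg (by omega)]
      congr 2; omega
  · obtain ⟨n, hn, hL⟩ := h (r - 1) (by omega) (m - 1) (by omega)
    obtain ⟨n', hn', hL'⟩ := h r (by omega) (m - 1) (by omega)
    refine Near.of_pos (a := n) (b := n') ?_ ?_ ?_
    · rw [hL]; unfold mSame
      rw [if_pos (by omega)]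
      congr 2; omega
    · rw [hL']; unfold mSame
      rw [if_neg (by omega)]
      congr 2; omega
    · have : ((r - 1 : ℕ) : ℤ) = r - 1 := by omega
      rw [hn, hn', this]
      rcases hσ with rfl | rfl
      · left; ring
      · right; ring

theorem Rz.diff {V : Type} {M r m : ℕ} {U W : ℕ → ℕ → V} {L : List V} (hr : 1 ≤ r) (hm : 1 ≤ m)
    (h : Rz M r (2 * m) (mDiff m U W) L) :
    Rz M r m U L ∧ Rz M r m W L ∧ Near 1 (U 0 (m - 1)) (W 0 (m - 1)) L := by
  obtain ⟨q, σ, τ, hσ, hτ, h⟩ := h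
  refine ⟨⟨q, σ, τ, hσ, hτ, fun j hj s hs => ?_⟩,
    ⟨q + τ * (2 * m - 1), σ, -τ, hσ, by omega, fun j hj s hs => ?_⟩, ?_⟩
  · obtain ⟨n, hn, hL⟩ := h j hj s (by omega)
    refine ⟨n, hn, ?_⟩
    rw [hL]; unfold mDiff
    rw [if_pos (by omega)]
  · obtain ⟨n, hn, hL⟩ := h j hj (2 * m - 1 - s) (by omega)
    refine ⟨n, ?_, ?_⟩
    · have : ((2 * m - 1 - s : ℕ) : ℤ) = 2 * m - 1 - s := by omega
      rw [hn, this]; ring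
    · rw [hL]; unfold mDiff
      rw [if_neg (by omega)]
      congr 2; omega
  · obtain ⟨n, hn, hL⟩ := h 0 (by omega) (m - 1) (by omega)
    obtain ⟨n', hn', hL'⟩ := h 0 (by omega) m (by omega)
    refine Near.of_pos (a := n) (b := n') ?_ ?_ ?_
    · rw [hL]; unfold mDiff
      rw [if_pos (by omega)]
    · rw [hL']; unfold mDiff
      rw [if_neg (by omega)]
      congr 2; omega
    · have : ((m - 1 : ℕ) : ℤ) = m - 1 := by omega
      rw [hn, hn', this]
      rcases hτ with rfl | rfl
      · left; push_cast; ring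
      · right; push_cast; ring

/-! ### Separated families -/

/-- for any `N` combs of type `i` there is a pairwise separated family indexed by `ι`
of lists using all elements and realizing all combs. -/
def Fam (ℓ i N : ℕ) (ι : Type) : Prop :=
  ∀ (V J : Type) [Fintype J], Fintype.card J = N → ∀ r : ℕ, 1 ≤ r → ∀ C : J → ℕ → ℕ → V,
    ∃ f : ι → List V, (∀ k, (f k : Multiset V) = ∑ j, el r (2 ^ i) (C j)) ∧
      (∀ k j, Rz (2 ^ ℓ) r (2 ^ i) (C j) (f k)) ∧
      ∀ k k', k ≠ k' → ∀ c, Separated (2 ^ ℓ) (c :: f k) (c :: f k')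

theorem fam_zero (ℓ i : ℕ) : Fam ℓ i 0 Unit := by
  intro V J _ hJ r hr C
  have : IsEmpty J := Fintype.card_eq_zero_iff.1 hJ
  exact ⟨fun _ => [], by simp, fun _ j => isEmptyElim j, fun k k' h => absurd rfl h⟩

theorem sum_range_mul_div {A : Type} [AddCommMonoid A] (r M : ℕ) (hM : 0 < M) (g : ℕ → ℕ → A) :
    ∑ n ∈ Finset.range (r * M), g (n / M) (n % M) =
      ∑ j ∈ Finset.range r, ∑ s ∈ Finset.range M, g j s := by
  induction r with
  | zero => simp
  | succ r ih =>
    rw [add_mul, one_mul, Finset.sum_range_add, ih, Finset.sum_range_succ]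
    congr 1
    refine Finset.sum_congr rfl fun s hs => ?_
    have hs := Finset.mem_range.1 hs
    congr 1
    · rw [Nat.add_comm, Nat.add_mul_div_right _ _ hM, Nat.div_eq_of_lt hs, zero_add]
    · rw [Nat.add_comm, Nat.add_mul_mod_self_right, Nat.mod_eq_of_lt hs]

theorem coe_map_range {V : Type} (n : ℕ) (g : ℕ → V) :
    (((List.range n).map g : List V) : Multiset V) = ∑ x ∈ Finset.range n, ({g x} : Multiset V) := by
  induction n with
  | zero => simp
  | succ n ih =>
    rw [List.range_succ, List.map_append, ← Multiset.coe_add, ih, Finset.sum_range_succ]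
    simp

theorem fam_base (ℓ : ℕ) : Fam ℓ ℓ 1 Bool := by
  intro V J _ hJ r hr C
  obtain ⟨j0, hj0⟩ := Fintype.card_eq_one_iff.1 hJ
  have hM : 0 < 2 ^ ℓ := by positivity
  have huniv : (Finset.univ : Finset J) = {j0} := by
    ext j; simp [hj0 j]
  set M := 2 ^ ℓ with hMdef
  let D := C j0
  have lt1 : ∀ j < r, ∀ s < M, j * M + s < r * M := fun j hj s hs => by nlinarith
  have dv : ∀ j s, s < M → (j * M + s) / M = j := fun j s hs => by
    rw [Nat.add_comm, Nat.add_mul_div_right _ _ hM, Nat.div_eq_of_lt hs, zero_add]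
  have md : ∀ j s, s < M → (j * M + s) % M = s := fun j s hs => by
    rw [Nat.add_comm, Nat.add_mul_mod_self_right, Nat.mod_eq_of_lt hs]
  let T := (List.range (r * M)).map fun n => D (n / M) (n % M)
  let F := (List.range (r * M)).map fun n => D (n / M) (M - 1 - n % M)
  have hT : ∀ j < r, ∀ s < M, T[j * M + s]? = some (D j s) := fun j hj s hs => by
    simp [T, lt1 j hj s hs, dv j s hs, md j s hs]
  have hF : ∀ j < r, ∀ s < M, F[j * M + s]? = some (D j (M - 1 - s)) := fun j hj s hs => by
    simp [F, lt1 j hj s hs, dv j s hs, md j s hs]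
  have sepTF : ∀ c, Near 1 c (D 0 0) (c :: T) := fun c => by
    have := hT 0 (by omega) 0 hM
    exact ⟨0, Or.inl ⟨by simp, by simpa using this⟩⟩
  have sepF : ∀ c, Near M c (D 0 0) (c :: F) := fun c => by
    have := hF 0 (by omega) (M - 1) (by omega)
    refine ⟨0, Or.inl ⟨by simp, ?_⟩⟩
    have e : 0 + M = (M - 1) + 1 := by omega
    rw [e, List.getElem?_cons_succ]
    simpa using this
  refine ⟨fun b => if b then T else F, ?_, ?_, ?_⟩
  · intro b
    rw [huniv, Finset.sum_singleton]
    cases b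
    · simp only [Bool.false_eq_true, if_false, F]
      rw [coe_map_range, sum_range_mul_div r M hM (fun j s => ({D j (M - 1 - s)} : Multiset V))]
      unfold el
      refine Finset.sum_congr rfl fun j _ => ?_
      rw [← Finset.sum_range_reflect]
      refine Finset.sum_congr rfl fun s hs => ?_
      have hs := Finset.mem_range.1 hs
      congr 2; omega
    · simp only [if_true, T]
      rw [coe_map_range, sum_range_mul_div r M hM (fun j s => ({D j s} : Multiset V))]
      rfl
  · intro b j
    rw [hj0 j]
    cases b
    · refine ⟨M - 1, 1, -1, by simp, by simp, fun j hj s hs => ⟨j * M + (M - 1 - s), ?_, ?_⟩⟩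
      · have : ((M - 1 - s : ℕ) : ℤ) = M - 1 - s := by omega
        push_cast [this]; ring
      · have := hF j hj (M - 1 - s) (by omega)
        simp only [Bool.false_eq_true, if_false]
        rw [this]
        congr 2; omega
    · refine ⟨0, 1, 1, by simp, by simp, fun j hj s hs => ⟨j * M + s, ?_, ?_⟩⟩
      · push_cast; ring
      · simpa using hT j hj s hs
  · intro k k' hk c
    cases k <;> cases k' <;> simp only [ne_eq, not_true_eq_false] at hk
    · exact ⟨c, D 0 0, Or.inr ⟨sepF c, sepTF c⟩⟩
    · exact ⟨c, D 0 0, Or.inl ⟨sepTF c, sepF c⟩⟩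

/-- separating concatenated lists. -/
theorem sep_append {V : Type} {M : ℕ} {ι κ : Type} (f : ι → List V) (g : κ → List V)
    (hf : ∀ k k', k ≠ k' → ∀ c, Separated M (c :: f k) (c :: f k'))
    (hg : ∀ k k', k ≠ k' → ∀ c, Separated M (c :: g k) (c :: g k')) (a a' : ι) (b b' : κ)
    (h : (a, b) ≠ (a', b')) (c : V) : Separated M (c :: (f a ++ g b)) (c :: (f a' ++ g b')) := by
  by_cases ha : a = a'
  · subst ha
    have hb : b ≠ b' := fun hb => h (by rw [hb])
    have hne : c :: f a ≠ [] := by simp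
    have e : ∀ X, c :: (f a ++ X) = (c :: f a).dropLast ++ ((c :: f a).getLast hne :: X) ++ [] := by
      intro X
      rw [List.append_nil]
      conv_lhs => rw [← List.cons_append, ← List.dropLast_append_getLast hne]
      simp
    rw [e, e]
    exact (hg b b' hb _).mid _ _ _ _
  · have := (hf a a' ha c).mid [] (g b) [] (g b')
    simpa using this

theorem fam_append {ℓ i a b : ℕ} {ι κ : Type} (h1 : Fam ℓ i a ι) (h2 : Fam ℓ i b κ) :
    Fam ℓ i (a + b) (ι × κ) := by
  intro V J _ hJ r hr C
  have e : J ≃ Fin a ⊕ Fin b := Fintype.equivOfCardEq (by simp [hJ])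
  obtain ⟨f, hf1, hf2, hf3⟩ := h1 V (Fin a) (by simp) r hr (fun x => C (e.symm (Sum.inl x)))
  obtain ⟨g, hg1, hg2, hg3⟩ := h2 V (Fin b) (by simp) r hr (fun x => C (e.symm (Sum.inr x)))
  refine ⟨fun k => f k.1 ++ g k.2, ?_, ?_, ?_⟩
  · intro k
    rw [← Multiset.coe_add, hf1, hg1, ← Equiv.sum_comp e.symm, Fintype.sum_sum_type]
  · intro k j
    obtain ⟨x, rfl⟩ := e.symm.surjective j
    rcases x with x | x
    · simpa using (hf2 k.1 x).mid [] (g k.2)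
    · simpa using (hg2 k.2 x).mid (f k.1) []
  · rintro ⟨a, b⟩ ⟨a', b'⟩ h c
    exact sep_append f g hf3 hg3 a a' b b' h c

theorem fam_forced {ℓ i N : ℕ} {ι : Type} (h : Fam ℓ (i + 1) N ι) : Fam ℓ i (2 * N) ι := by
  intro V J _ hJ r hr C
  have e : J ≃ Fin N × Bool := Fintype.equivOfCardEq (by simp [hJ, mul_comm])
  obtain ⟨f, hf1, hf2, hf3⟩ := h V (Fin N) (by simp) r hr
    (fun x => mDiff (2 ^ i) (C (e.symm (x, true))) (C (e.symm (x, false))))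
  have hp : 2 ^ (i + 1) = 2 * 2 ^ i := by ring
  have h1 : 1 ≤ 2 ^ i := Nat.one_le_two_pow
  refine ⟨f, ?_, ?_, hf3⟩
  · intro k
    rw [hf1, ← Equiv.sum_comp e.symm, Fintype.sum_prod_type]
    refine Finset.sum_congr rfl fun x _ => ?_
    rw [hp, el_diff]
    simp
  · intro k j
    obtain ⟨⟨x, b⟩, rfl⟩ := e.symm.surjective j
    have := hf2 k x
    rw [hp] at this
    have := this.diff hr h1
    cases b
    · exact this.2.1
    · exact this.1

theorem fam_split {ℓ i a b : ℕ} {ι κ : Type} (h1 : Fam ℓ i a ι) (h2 : Fam ℓ (i + 1) b κ) :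
    Fam ℓ i (2 * (a + b)) ({s : Finset (Fin (a + b)) // s.card = a} × ι × κ) := by
  classical
  intro V J _ hJ r hr C
  have e : J ≃ Fin (a + b) × Bool := Fintype.equivOfCardEq (by simp [hJ, mul_comm])
  have hp : 2 ^ (i + 1) = 2 * 2 ^ i := by ring
  have hi : 1 ≤ 2 ^ i := Nat.one_le_two_pow
  let U : Fin (a + b) → ℕ → ℕ → V := fun x => C (e.symm (x, true))
  let W : Fin (a + b) → ℕ → ℕ → V := fun x => C (e.symm (x, false))
  have key1 : ∀ s : {s : Finset (Fin (a + b)) // s.card = a}, _ := fun s =>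
    h1 V {x // x ∈ s.1} (by simp [s.2]) (2 * r) (by omega) (fun x => mSame r (U x) (W x))
  have key2 : ∀ s : {s : Finset (Fin (a + b)) // s.card = a}, _ := fun s =>
    h2 V {x // x ∉ s.1} (by rw [Fintype.card_subtype_compl]; simp [s.2]) r hr
      (fun x => mDiff (2 ^ i) (U x) (W x))
  choose f hf1 hf2 hf3 using key1
  choose g hg1 hg2 hg3 using key2
  rw [hp] at hg1 hg2
  have A1 : ∀ s (k : ι × κ) (x) (hx : x ∈ s.1), Rz (2 ^ ℓ) r (2 ^ i) (U x) (f s k.1 ++ g s k.2) ∧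
      Rz (2 ^ ℓ) r (2 ^ i) (W x) (f s k.1 ++ g s k.2) ∧
      Near (2 ^ ℓ) (U x 0 (2 ^ i - 1)) (W x 0 (2 ^ i - 1)) (f s k.1 ++ g s k.2) := by
    intro s k x hx
    have := (hf2 s k.1 ⟨x, hx⟩).mid [] (g s k.2)
    exact this.same hr hi
  have A2 : ∀ s (k : ι × κ) (x) (hx : x ∉ s.1), Rz (2 ^ ℓ) r (2 ^ i) (U x) (f s k.1 ++ g s k.2) ∧
      Rz (2 ^ ℓ) r (2 ^ i) (W x) (f s k.1 ++ g s k.2) ∧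
      Near 1 (U x 0 (2 ^ i - 1)) (W x 0 (2 ^ i - 1)) (f s k.1 ++ g s k.2) := by
    intro s k x hx
    have := (hg2 s k.2 ⟨x, hx⟩).mid (f s k.1) []
    rw [List.append_nil] at this
    exact this.diff hr hi
  refine ⟨fun k => f k.1 k.2.1 ++ g k.1 k.2.2, ?_, ?_, ?_⟩
  · rintro ⟨s, k⟩
    simp only
    rw [← Multiset.coe_add, hf1, hg1, ← Equiv.sum_comp e.symm, Fintype.sum_prod_type]
    rw [← Fintype.sum_subtype_add_sum_subtype (fun x => x ∈ s.1)]
    congr 1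
    · refine Finset.sum_congr (by ext; simp) fun x _ => ?_
      rw [el_same]; simp [U, W]
    · refine Finset.sum_congr rfl fun x _ => ?_
      rw [el_diff]; simp [U, W]
  · rintro ⟨s, k⟩ j
    obtain ⟨⟨x, b⟩, rfl⟩ := e.symm.surjective j
    by_cases hx : x ∈ s.1
    · have := A1 s k x hx
      cases b
      · exact this.2.1
      · exact this.1
    · have := A2 s k x hx
      cases b
      · exact this.2.1
      · exact this.1
  · rintro ⟨s, k⟩ ⟨s', k'⟩ hk c
    by_cases hs : s = s'
    · subst hs
      exact sep_append (f s) (g s) (hf3 s) (hg3 s) k.1 k'.1 k.2 k'.2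
        (fun h => hk (by rw [Prod.mk.injEq]; exact ⟨rfl, h⟩)) c
    · have : ¬ s.1 ⊆ s'.1 := fun hsub =>
        hs (Subtype.ext (Finset.eq_of_subset_of_card_le hsub (by rw [s.2, s'.2])))
      obtain ⟨x, hx, hx'⟩ := Finset.not_subset.1 this
      have n1 := (A1 s k x hx).2.2.mid [c] []
      have n2 := (A2 s' k' x hx').2.2.mid [c] []
      refine ⟨U x 0 (2 ^ i - 1), W x 0 (2 ^ i - 1), Or.inr ⟨?_, ?_⟩⟩
      · simpa using n1
      · simpa using n2

/-! ### Graph part -/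

theorem not_containsCycleLen_of_coloring {V : Type*} {G : SimpleGraph V} {k : ℕ} (c : V → Bool)
    (hc : ∀ a b, G.Adj a b → c a ≠ c b) (hk : Odd k) : ¬ ContainsCycleLen G k := by
  rintro ⟨u, w, -, hw⟩
  let C : G.Coloring Bool := Coloring.mk c (fun {a b} h => hc a b h)
  have := (C.even_length_iff_congr w).2 Iff.rfl
  rw [hw] at this
  exact (Nat.not_even_iff_odd.2 hk) this

/-- the parity coloring attached to a relabeling. -/
def parCol {n : ℕ} (σ : Equiv.Perm (Fin n)) : Fin n → Bool := fun v => decide ((σ v).val % 2 = 0)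

theorem parCol_ne {n : ℕ} (σ : Equiv.Perm (Fin n)) (a b : Fin n)
    (h : (pathGraph n).Adj (σ a) (σ b)) : parCol σ a ≠ parCol σ b := by
  rw [pathGraph_adj] at h
  unfold parCol
  intro h'
  rw [decide_eq_decide] at h'
  omega

theorem odd_pow_add_one {ℓ : ℕ} (hℓ : 1 ≤ ℓ) : Odd (2 ^ ℓ + 1) := by
  refine Even.add_one ?_
  exact (Nat.even_pow.2 ⟨even_two, by omega⟩)

theorem family_card_le {n k : ℕ} (hk : Odd k) (F : Finset (SimpleGraph (Fin n)))
    (h1 : ∀ G ∈ F, IsHamPathGraph G)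
    (h2 : ∀ G₁ ∈ F, ∀ G₂ ∈ F, G₁ ≠ G₂ → ContainsCycleLen (G₁ ⊔ G₂) k) : F.card ≤ 2 ^ n := by
  classical
  choose! σ hσ using h1
  have : F.card ≤ (Finset.univ : Finset (Fin n → Bool)).card := by
    refine Finset.card_le_card_of_injOn (fun G => parCol (σ G)) (by simp) ?_
    intro G₁ hG₁ G₂ hG₂ heq
    by_contra hne
    refine not_containsCycleLen_of_coloring (parCol (σ G₁)) ?_ hk (h2 G₁ hG₁ G₂ hG₂ hne)
    intro a b hab
    rcases hab with hab | hab
    · exact parCol_ne _ _ _ ((hσ G₁ hG₁ a b).1 hab)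
    · have heq : parCol (σ G₁) = parCol (σ G₂) := heq
      rw [heq]
      exact parCol_ne _ _ _ ((hσ G₂ hG₂ a b).1 hab)
  simpa using this

theorem hnum_le {n k : ℕ} (hk : Odd k) : Hnum n k ≤ 2 ^ n := by
  refine csSup_le ⟨0, ∅, by simp⟩ ?_
  rintro m ⟨F, rfl, h1, h2⟩
  exact family_card_le hk F h1 h2

theorem le_hnum {n k : ℕ} (hk : Odd k) (F : Finset (SimpleGraph (Fin n)))
    (h1 : ∀ G ∈ F, IsHamPathGraph G)
    (h2 : ∀ G₁ ∈ F, ∀ G₂ ∈ F, G₁ ≠ G₂ → ContainsCycleLen (G₁ ⊔ G₂) k) : F.card ≤ Hnum n k := by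
  refine le_csSup ⟨2 ^ n, ?_⟩ ⟨F, rfl, h1, h2⟩
  rintro m ⟨F, rfl, h1, h2⟩
  exact family_card_le hk F h1 h2

theorem exists_path {n : ℕ} (σ : Equiv.Perm (Fin n)) (v : Fin n) (M : ℕ) :
    ∀ u : Fin n, (σ u).val + M = (σ v).val →
      ∃ p : ((pathGraph n).comap σ).Walk u v, p.IsPath ∧ p.length = M ∧
        ∀ x ∈ p.support, (σ u).val ≤ (σ x).val := by
  induction M with
  | zero =>
    intro u h
    have : u = v := σ.injective (Fin.ext (by simpa using h))
    subst this
    exact ⟨Walk.nil, by simp⟩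
  | succ M ih =>
    intro u h
    have hlt : (σ u).val + 1 < n := by have := (σ v).isLt; omega
    let w := σ.symm ⟨(σ u).val + 1, hlt⟩
    have hw : (σ w).val = (σ u).val + 1 := by simp [w]
    obtain ⟨p, hp, hl, hs⟩ := ih w (by omega)
    have hadj : ((pathGraph n).comap σ).Adj u w := by
      rw [SimpleGraph.comap_adj, pathGraph_adj]
      left; omega
    refine ⟨Walk.cons hadj p, ?_, by simp [hl], ?_⟩
    · rw [Walk.cons_isPath_iff]
      refine ⟨hp, fun hu => ?_⟩
      have := hs u hu
      omega
    · intro x hx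
      rw [Walk.support_cons, List.mem_cons] at hx
      rcases hx with rfl | hx
      · exact le_rfl
      · have := hs x hx; omega

theorem cycle_of_pos {n : ℕ} {G : SimpleGraph (Fin n)} (σ : Equiv.Perm (Fin n))
    (hG : (pathGraph n).comap σ ≤ G) {M : ℕ} (hM : 2 ≤ M) {u v : Fin n} (huv : G.Adj v u)
    (h : (σ u).val + M = (σ v).val) : ContainsCycleLen G (M + 1) := by
  obtain ⟨p, hp, hl, -⟩ := exists_path σ v M u h
  refine ⟨v, Walk.cons huv (p.mapLe hG), ?_, by simp [hl]⟩
  rw [Walk.cons_isCycle_iff]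
  refine ⟨(Walk.isPath_mapLe hG).2 hp, fun he => ?_⟩
  rw [Walk.edges_mapLe_eq_edges] at he
  have := p.adj_of_mem_edges he
  rw [SimpleGraph.comap_adj, pathGraph_adj] at this
  omega

/-- relabeling attached to a list enumerating `Fin n`. -/
theorem exists_perm {n : ℕ} (L : List (Fin n)) (hL : (L : Multiset (Fin n)) = Finset.univ.val) :
    ∃ σ : Equiv.Perm (Fin n), ∀ (i : ℕ) (v : Fin n), L[i]? = some v → (σ v).val = i := by
  have hnd : L.Nodup := by
    rw [← Multiset.coe_nodup, hL]; exact Finset.univ.nodup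
  have hlen : L.length = n := by
    rw [← Multiset.coe_card, hL]; simp
  have hmem : ∀ v, v ∈ L := fun v => by
    rw [← Multiset.mem_coe, hL]; simp
  let f : Fin n → Fin n := fun v => ⟨L.idxOf v, by
    have := List.idxOf_lt_length_iff.2 (hmem v); omega⟩
  have hf : Function.Injective f := by
    intro a b hab
    have : L.idxOf a = L.idxOf b := by simpa [f] using hab
    exact (List.idxOf_inj (hmem a)).1 this
  refine ⟨Equiv.ofBijective f (Finite.injective_iff_bijective.1 hf), ?_⟩
  intro i v hi
  obtain ⟨hlt, rfl⟩ := List.getElem?_eq_some_iff.1 hi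
  simp only [Equiv.ofBijective_apply, f]
  exact hnd.idxOf_getElem i hlt

theorem near_pos {n d : ℕ} {L : List (Fin n)} {σ : Equiv.Perm (Fin n)}
    (hσ : ∀ (i : ℕ) (v : Fin n), L[i]? = some v → (σ v).val = i) {u v : Fin n}
    (h : Near d u v L) : (σ u).val + d = (σ v).val ∨ (σ v).val + d = (σ u).val := by
  obtain ⟨i, ⟨h1, h2⟩ | ⟨h1, h2⟩⟩ := h
  · left; rw [hσ _ _ h1, hσ _ _ h2]
  · right; rw [hσ _ _ h1, hσ _ _ h2]

theorem cycle_of_near {n M : ℕ} (hM : 2 ≤ M) {G : SimpleGraph (Fin n)} {L L' : List (Fin n)}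
    {σ σ' : Equiv.Perm (Fin n)}
    (hσ : ∀ (i : ℕ) (v : Fin n), L[i]? = some v → (σ v).val = i)
    (hσ' : ∀ (i : ℕ) (v : Fin n), L'[i]? = some v → (σ' v).val = i)
    (hG : (pathGraph n).comap σ ≤ G) (hG' : (pathGraph n).comap σ' ≤ G) {u v : Fin n}
    (h : Near 1 u v L) (h' : Near M u v L') : ContainsCycleLen G (M + 1) := by
  have hadj : G.Adj u v := by
    apply hG
    rw [SimpleGraph.comap_adj, pathGraph_adj]
    exact near_pos hσ h
  rcases near_pos hσ' h' with h | h
  · exact cycle_of_pos σ' hG' hM hadj.symm h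
  · exact cycle_of_pos σ' hG' hM hadj h

theorem card_le_hnum {ℓ : ℕ} (hℓ : 1 ≤ ℓ) (Q d : ℕ) (ι : Type) [Fintype ι] (h : Fam ℓ 0 Q ι) :
    Fintype.card ι ≤ Hnum (Q + (d + 1)) (2 ^ ℓ + 1) := by
  classical
  set n := Q + (d + 1) with hn
  obtain ⟨f, hf1, -, hf3⟩ := h (Fin n) (Fin Q) (by simp) 1 le_rfl
    (fun j _ _ => Fin.castAdd (d + 1) j)
  let c : Fin n := Fin.natAdd Q 0
  let R : List (Fin n) := (∑ x : Fin d, ({Fin.natAdd Q x.succ} : Multiset (Fin n))).toList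
  let L : ι → List (Fin n) := fun k => c :: f k ++ R
  have hL : ∀ k, (L k : Multiset (Fin n)) = Finset.univ.val := by
    intro k
    rw [← Finset.sum_multiset_singleton, Fin.sum_univ_add, Fin.sum_univ_succ]
    simp only [L]
    rw [← Multiset.coe_add, ← Multiset.cons_coe, hf1]
    simp only [R, Multiset.coe_toList, el, pow_zero, Finset.range_one, Finset.sum_singleton, c]
    rw [← Multiset.singleton_add]
    abel
  choose σ hσ using fun k => exists_perm (L k) (hL k)
  let G : ι → SimpleGraph (Fin n) := fun k => (pathGraph n).comap (σ k)
  have hM : 2 ≤ 2 ^ ℓ := by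
    calc 2 = 2 ^ 1 := by norm_num
      _ ≤ 2 ^ ℓ := Nat.pow_le_pow_right (by norm_num) hℓ
  have hcyc : ∀ k k', k ≠ k' → ContainsCycleLen (G k ⊔ G k') (2 ^ ℓ + 1) := by
    intro k k' hk
    have hs : Separated (2 ^ ℓ) (L k) (L k') := by
      simpa [L] using (hf3 k k' hk c).mid [] R [] R
    obtain ⟨u, v, ⟨h1, h2⟩ | ⟨h1, h2⟩⟩ := hs
    · exact cycle_of_near hM (hσ k) (hσ k') le_sup_left le_sup_right h1 h2
    · exact cycle_of_near hM (hσ k') (hσ k) le_sup_right le_sup_left h2 h1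
  have hinj : Function.Injective G := by
    intro k k' heq
    by_contra hne
    have := hcyc k k' hne
    rw [← heq, sup_idem] at this
    exact not_containsCycleLen_of_coloring (parCol (σ k)) (fun a b hab => parCol_ne _ _ _ hab)
      (odd_pow_add_one hℓ) this
  have := le_hnum (odd_pow_add_one hℓ) (Finset.univ.image G) ?_ ?_
  · rwa [Finset.card_image_of_injective _ hinj, Finset.card_univ] at this
  · intro H hH
    obtain ⟨k, -, rfl⟩ := Finset.mem_image.1 hH
    exact ⟨σ k, fun a b => Iff.rfl⟩
  · intro H hH H' hH' hne
    obtain ⟨k, -, rfl⟩ := Finset.mem_image.1 hH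
    obtain ⟨k', -, rfl⟩ := Finset.mem_image.1 hH'
    exact hcyc k k' (fun e => hne (by rw [e]))

/-! ### Counting -/

/-- there are families of exponential rate at least `1 - δ`. -/
def Rt (ℓ i : ℕ) (δ : ℝ) : Prop :=
  ∃ N : ℕ, 0 < N ∧ ∃ (ι : Type) (_ : Fintype ι), Fam ℓ i N ι ∧
    (2 : ℝ) ^ ((1 - δ) * N) ≤ (Fintype.card ι : ℝ)

theorem fam_mul {ℓ i N : ℕ} {ι : Type} [Fintype ι] (h : Fam ℓ i N ι) (q : ℕ) :
    ∃ (κ : Type) (_ : Fintype κ), Fam ℓ i (q * N) κ ∧ Fintype.card κ = Fintype.card ι ^ q := by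
  induction q with
  | zero => exact ⟨Unit, inferInstance, by simpa using fam_zero ℓ i, by simp⟩
  | succ q ih =>
    obtain ⟨κ, hκ, hf, hc⟩ := ih
    refine ⟨κ × ι, inferInstance, ?_, ?_⟩
    · rw [add_mul, one_mul]; exact fam_append hf h
    · rw [Fintype.card_prod, hc, pow_succ]

theorem Rt.mul {ℓ i : ℕ} {δ : ℝ} (h : Rt ℓ i δ) : ∃ N : ℕ, 0 < N ∧ ∀ q : ℕ,
    ∃ (κ : Type) (_ : Fintype κ), Fam ℓ i (q * N) κ ∧
      (2 : ℝ) ^ ((1 - δ) * ((q * N : ℕ) : ℝ)) ≤ (Fintype.card κ : ℝ) := by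
  obtain ⟨N, hN, ι, hι, hf, hc⟩ := h
  refine ⟨N, hN, fun q => ?_⟩
  obtain ⟨κ, hκ, hf', hc'⟩ := fam_mul hf q
  refine ⟨κ, hκ, hf', ?_⟩
  rw [hc']
  push_cast
  calc (2 : ℝ) ^ ((1 - δ) * ((q : ℝ) * N)) = ((2 : ℝ) ^ ((1 - δ) * N)) ^ q := by
        rw [← Real.rpow_natCast, ← Real.rpow_mul (by norm_num)]
        congr 1; ring
    _ ≤ _ := by gcongr

theorem eventually_small (δ : ℝ) (hδ : 0 < δ) :
    ∃ T : ℕ, ∀ x : ℕ, T ≤ x → (2 * x : ℝ) ≤ (2 : ℝ) ^ (δ * x / 2) := by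
  have hc : 1 < (2 : ℝ) ^ (δ / 2) := Real.one_lt_rpow (by norm_num) (by linarith)
  have := isLittleO_pow_const_const_pow_of_one_lt (R := ℝ) 1 hc
  have := this.bound (c := 1 / 2) (by norm_num)
  obtain ⟨T, hT⟩ := Filter.eventually_atTop.1 this
  refine ⟨T, fun x hx => ?_⟩
  have := hT x hx
  rw [pow_one, Real.norm_of_nonneg (by positivity), Real.norm_of_nonneg (by positivity)] at this
  have e : (2 : ℝ) ^ (δ * x / 2) = ((2 : ℝ) ^ (δ / 2)) ^ x := by
    rw [← Real.rpow_natCast, ← Real.rpow_mul (by norm_num)]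
    congr 1; ring
  rw [e]
  linarith

theorem Rt.half {ℓ i : ℕ} {δ : ℝ} (hδ : 0 < δ) (h : Rt ℓ i δ) (h' : Rt ℓ (i + 1) (δ / 2)) :
    Rt ℓ i (δ / 2) := by
  obtain ⟨N1, hN1, h1⟩ := h.mul
  obtain ⟨N2, hN2, h2⟩ := h'.mul
  obtain ⟨T, hT⟩ := eventually_small δ hδ
  set t := T + 1 with ht
  set a := t * N2 * N1 with ha
  have ha' : t * N1 * N2 = a := by rw [ha]; ring
  have hNN : 0 < N2 * N1 := Nat.mul_pos hN2 hN1
  have haT : T ≤ a := by rw [ha, mul_assoc]; nlinarith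
  have hapos : 0 < a := by positivity
  obtain ⟨κ1, i1, f1, c1⟩ := h1 (t * N2)
  obtain ⟨κ2, i2, f2, c2⟩ := h2 (t * N1)
  rw [ha'] at f2 c2
  rw [← ha] at f1 c1
  refine ⟨2 * (a + a), by omega, _, inferInstance, fam_split f1 f2, ?_⟩
  have hcard : Fintype.card {s : Finset (Fin (a + a)) // s.card = a} = Nat.centralBinom a := by
    rw [Fintype.card_finset_len, Fintype.card_fin, Nat.centralBinom_eq_two_mul_choose, two_mul]
  rw [Fintype.card_prod, Fintype.card_prod, hcard]
  have hb : (4 : ℝ) ^ a ≤ 2 * a * Nat.centralBinom a := by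
    exact_mod_cast Nat.four_pow_le_two_mul_self_mul_centralBinom a hapos
  have hsm := hT a haT
  have h4 : (4 : ℝ) ^ a = (2 : ℝ) ^ (2 * (a : ℝ)) := by
    rw [Real.rpow_mul (by norm_num), Real.rpow_natCast]; norm_num
  have hb' : (2 : ℝ) ^ (2 * (a : ℝ) - δ * a / 2) ≤ Nat.centralBinom a := by
    rw [Real.rpow_sub (by norm_num), div_le_iff₀ (by positivity), ← h4]
    calc (4 : ℝ) ^ a ≤ 2 * a * Nat.centralBinom a := hb
      _ ≤ (2 : ℝ) ^ (δ * a / 2) * Nat.centralBinom a := by gcongr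
      _ = _ := by ring
  push_cast
  calc (2 : ℝ) ^ ((1 - δ / 2) * (2 * ((a : ℝ) + a)))
      = (2 : ℝ) ^ (2 * (a : ℝ) - δ * a / 2) * ((2 : ℝ) ^ ((1 - δ) * (a : ℝ)) *
          (2 : ℝ) ^ ((1 - δ / 2) * (a : ℝ))) := by
        rw [← Real.rpow_add (by norm_num), ← Real.rpow_add (by norm_num)]
        congr 1; ring
    _ ≤ _ := by gcongr

theorem Rt.mono {ℓ i : ℕ} {δ δ' : ℝ} (h : Rt ℓ i δ) (hd : δ ≤ δ') : Rt ℓ i δ' := by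
  obtain ⟨N, hN, ι, hι, hf, hc⟩ := h
  refine ⟨N, hN, ι, hι, hf, le_trans ?_ hc⟩
  apply Real.rpow_le_rpow_of_exponent_le (by norm_num)
  gcongr

theorem Rt.forced {ℓ i : ℕ} {δ : ℝ} (h : Rt ℓ (i + 1) δ) (hd : δ ≤ 1) : Rt ℓ i 1 := by
  obtain ⟨N, hN, ι, hι, hf, hc⟩ := h
  refine ⟨2 * N, by omega, ι, hι, fam_forced hf, le_trans ?_ hc⟩
  apply Real.rpow_le_rpow_of_exponent_le (by norm_num)
  have : 0 ≤ (1 - δ) * (N : ℝ) := mul_nonneg (by linarith) (by positivity)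
  linarith

theorem Rt.down {ℓ i : ℕ} (h : ∀ δ : ℝ, 0 < δ → Rt ℓ (i + 1) δ) (δ : ℝ) (hδ : 0 < δ) :
    Rt ℓ i δ := by
  have key : ∀ t : ℕ, Rt ℓ i ((1 / 2) ^ t) := by
    intro t
    induction t with
    | zero => simpa using (h 1 one_pos).forced le_rfl
    | succ t ih =>
      have e : ((1 : ℝ) / 2) ^ (t + 1) = (1 / 2) ^ t / 2 := by ring
      rw [e]
      exact ih.half (by positivity) (h _ (by positivity))
  obtain ⟨t, ht⟩ := exists_pow_lt_of_lt_one hδ (by norm_num : (1 : ℝ) / 2 < 1)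
  exact (key t).mono ht.le

theorem rt_all (ℓ : ℕ) (e : ℕ) : ∀ i, i + e = ℓ → ∀ δ : ℝ, 0 < δ → Rt ℓ i δ := by
  induction e with
  | zero =>
    intro i hi δ hδ
    obtain rfl : i = ℓ := by omega
    refine Rt.mono (δ := 0) ⟨1, one_pos, Bool, inferInstance, fam_base i, ?_⟩ hδ.le
    simp
  | succ e ih =>
    intro i hi
    exact Rt.down (ih (i + 1) (by omega))

/-- Kovács–Soltész: `H(n, 2^ℓ + 1) = 2^(n - o(n))`. -/
theorem stmt_2 (ℓ : ℕ) (hℓ : 1 ≤ ℓ) :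
    ∀ ε : ℝ, 0 < ε → ∃ N : ℕ, ∀ n : ℕ, N ≤ n →
      (2 : ℝ) ^ ((1 - ε) * n) ≤ (Hnum n (2 ^ ℓ + 1) : ℝ) ∧
      (Hnum n (2 ^ ℓ + 1) : ℝ) ≤ (2 : ℝ) ^ ((1 + ε) * n) := by
  intro ε hε
  set δ := min ε 1 / 2 with hδ
  have hδ0 : 0 < δ := by have : 0 < min ε 1 := lt_min hε one_pos
                         linarith
  have hδε : 2 * δ ≤ ε := by have := min_le_left ε 1
                             linarith
  have hδ1 : 2 * δ ≤ 1 := by have := min_le_right ε 1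
                             linarith
  obtain ⟨N, hN, h⟩ := (rt_all ℓ ℓ 0 (by omega) δ hδ0).mul
  obtain ⟨B, hB⟩ := exists_nat_ge ((N : ℝ) / δ)
  refine ⟨B + 1, fun n hn => ⟨?_, ?_⟩⟩
  · obtain ⟨κ, hκ, hf, hc⟩ := h ((n - 1) / N)
    have hle : (n - 1) / N * N ≤ n - 1 := Nat.div_mul_le_self _ _
    have hgt : n - 1 < (n - 1) / N * N + N := Nat.lt_div_mul_add hN
    set Q := (n - 1) / N * N with hQ
    obtain ⟨d, hd⟩ : ∃ d, n = Q + (d + 1) := ⟨n - 1 - Q, by omega⟩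
    have hcard := card_le_hnum hℓ Q d κ hf
    rw [← hd] at hcard
    have hcard' : (Fintype.card κ : ℝ) ≤ Hnum n (2 ^ ℓ + 1) := by exact_mod_cast hcard
    refine le_trans ?_ (hc.trans hcard')
    apply Real.rpow_le_rpow_of_exponent_le (by norm_num)
    have hQn : (n : ℝ) ≤ Q + N := by
      have : n ≤ Q + N := by omega
      exact_mod_cast this
    have hnB : (B : ℝ) ≤ n := by exact_mod_cast (by omega : B ≤ n)
    have hND : (N : ℝ) ≤ δ * n := by
      have := hB.trans hnB
      rw [div_le_iff₀ hδ0] at this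
      linarith
    have hn0 : (0 : ℝ) ≤ n := by positivity
    have hN0 : (0 : ℝ) ≤ N := by positivity
    nlinarith [mul_nonneg (by linarith : (0 : ℝ) ≤ 1 - δ) (by linarith : (0 : ℝ) ≤ Q + N - n),
      mul_nonneg (by linarith : (0 : ℝ) ≤ ε - 2 * δ) hn0, mul_nonneg hδ0.le hN0]
  · have h1 : (Hnum n (2 ^ ℓ + 1) : ℝ) ≤ (2 : ℝ) ^ n := by
      exact_mod_cast hnum_le (n := n) (odd_pow_add_one hℓ)
    refine h1.trans ?_
    rw [← Real.rpow_natCast]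
    apply Real.rpow_le_rpow_of_exponent_le (by norm_num)
    have hn0 : (0 : ℝ) ≤ n := by positivity
    nlinarith [mul_nonneg hε.le hn0]
end

section
/- For every ε > 0 there exists N such that for all n ≥ N, H(n,4) ≤ n^{(3/4 + ε)n}. -/
open SimpleGraph

theorem tuples_count {E A B : Type*} [Fintype E] [DecidableEq E] [DecidableEq A] [DecidableEq B]
    (f : E → A) (g : E → B) (d k : ℕ)
    (hf : ∀ a, (Finset.univ.filter fun e => f e = a).card ≤ d)
    (hg : ∀ b, (Finset.univ.filter fun e => g e = b).card ≤ d) (j : ℕ) (hj : j ≤ k) :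
    (Fintype.card E - 2 * d * k) ^ j ≤
      (Finset.univ.filter fun e : Fin j → E =>
        Function.Injective (f ∘ e) ∧ Function.Injective (g ∘ e)).card := by
  induction j with
  | zero =>
    simp only [pow_zero]
    apply Finset.card_pos.mpr
    refine ⟨Fin.elim0, ?_⟩
    simp only [Finset.mem_filter, Finset.mem_univ, true_and]
    exact ⟨Function.injective_of_subsingleton _, Function.injective_of_subsingleton _⟩
  | succ j ih =>
    have ih := ih (by omega)
    set S := (Finset.univ.filter fun e : Fin j → E =>
        Function.Injective (f ∘ e) ∧ Function.Injective (g ∘ e)) with hS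
    let bad : (Fin j → E) → Finset E := fun e =>
      Finset.univ.biUnion fun i => (Finset.univ.filter fun x => f x = f (e i)) ∪
        (Finset.univ.filter fun x => g x = g (e i))
    have hbad : ∀ e, (bad e).card ≤ 2 * d * k := by
      intro e
      calc (bad e).card ≤ ∑ i : Fin j, ((Finset.univ.filter fun x => f x = f (e i)) ∪
        (Finset.univ.filter fun x => g x = g (e i))).card := Finset.card_biUnion_le
        _ ≤ ∑ i : Fin j, (2 * d) := by
          apply Finset.sum_le_sum
          intro i _
          refine (Finset.card_union_le _ _).trans ?_
          have := hf (f (e i)); have := hg (g (e i)); omega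
        _ ≤ 2 * d * k := by
          simp only [Finset.sum_const, Finset.card_univ, Fintype.card_fin, smul_eq_mul]
          rw [mul_comm]; gcongr; omega
    have h1 : (Fintype.card E - 2 * d * k) ^ (j + 1) ≤ (S.sigma fun e => (bad e)ᶜ).card := by
      rw [Finset.card_sigma, pow_succ]
      calc _ ≤ S.card * (Fintype.card E - 2 * d * k) := by gcongr
        _ = ∑ e ∈ S, (Fintype.card E - 2 * d * k) := by simp
        _ ≤ _ := by
          apply Finset.sum_le_sum
          intro e _
          rw [Finset.card_compl]
          have := hbad e
          omega
    refine h1.trans ?_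
    apply Finset.card_le_card_of_injOn (fun x => (Fin.cons x.2 x.1 : Fin (j+1) → E))
    · rintro ⟨e, x⟩ hx
      simp only [Finset.coe_sigma, Set.mem_sigma_iff, Finset.mem_coe, hS, Finset.mem_filter,
        Finset.mem_univ, true_and, bad, Finset.mem_compl, Finset.mem_biUnion, Finset.mem_union,
        not_exists, not_or] at hx ⊢
      obtain ⟨⟨h1, h2⟩, h3⟩ := hx
      constructor
      · intro a b hab
        induction a using Fin.cases <;> induction b using Fin.cases
        · rfl
        · simp at hab; exact absurd hab (h3 _).1
        · simp at hab; exact absurd hab.symm (h3 _).1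
        · simp at hab; rw [h1 hab]
      · intro a b hab
        induction a using Fin.cases <;> induction b using Fin.cases
        · rfl
        · simp at hab; exact absurd hab (h3 _).2
        · simp at hab; exact absurd hab.symm (h3 _).2
        · simp at hab; rw [h2 hab]
    · rintro ⟨e, x⟩ _ ⟨e', x'⟩ _ h
      simp only [Fin.cons_inj] at h
      obtain ⟨rfl, rfl⟩ := h
      rfl

/-- bipartite C4-freeness of a relation -/
def RelC4Free {A B : Type*} (R : A → B → Prop) : Prop :=
  ∀ a a' b b', R a b → R a b' → R a' b → R a' b' → a = a' ∨ b = b'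

theorem key_prime (p k : ℕ) [Fact p.Prime] (hk : 3 * k ≤ p ^ 2) :
    ∃ (R : Fin k → Fin k → Prop) (P : Finset (Equiv.Perm (Fin k))), RelC4Free R ∧
      (∀ π ∈ P, ∀ i, R i (π i)) ∧ p ^ k ≤ P.card * (2 ^ (p ^ 2) * 3 ^ k) := by
  classical
  have hp : 0 < p := (Fact.out : p.Prime).pos
  let E := (ZMod p × ZMod p) × ZMod p
  let f : E → ZMod p × ZMod p := fun e => e.1
  let g : E → ZMod p × ZMod p := fun e => (e.2, e.1.2 - e.2 * e.1.1)
  have hfg : ∀ e e', f e = f e' → g e = g e' → e = e' := by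
    rintro ⟨a, m⟩ ⟨a', m'⟩ h1 h2
    simp only [f, g, Prod.mk.injEq] at h1 h2
    simp [h1, h2.1]
  have hE : Fintype.card E = p ^ 3 := by
    simp only [E, Fintype.card_prod, ZMod.card]; ring
  have hf : ∀ a, (Finset.univ.filter fun e => f e = a).card ≤ p := by
    intro a
    calc _ ≤ (Finset.univ : Finset (ZMod p)).card := by
          apply Finset.card_le_card_of_injOn (fun e => e.2) (by simp)
          rintro e he e' he' h
          simp only [Finset.coe_filter, Finset.mem_univ, true_and, Set.mem_ofPred_eq, f] at he he'
          exact Prod.ext (he.trans he'.symm) h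
      _ = p := by simp [ZMod.card]
  have hg : ∀ a, (Finset.univ.filter fun e => g e = a).card ≤ p := by
    intro a
    calc _ ≤ (Finset.univ : Finset (ZMod p)).card := by
          apply Finset.card_le_card_of_injOn (fun e => e.1.1) (by simp)
          rintro ⟨⟨x, y⟩, m⟩ he ⟨⟨x', y'⟩, m'⟩ he' h
          simp only [Finset.coe_filter, Finset.mem_univ, true_and, Set.mem_ofPred_eq, g] at he he' h
          have := he.trans he'.symm
          simp only [Prod.mk.injEq] at this
          obtain ⟨rfl, h2⟩ := this
          subst h
          simp at h2
          rw [h2]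
      _ = p := by simp [ZMod.card]
  have hcount := tuples_count f g p k hf hg k le_rfl
  set S := (Finset.univ.filter fun e : Fin k → E =>
        Function.Injective (f ∘ e) ∧ Function.Injective (g ∘ e)) with hS
  rw [hE] at hcount
  let key : (Fin k → E) → (Fin k → ZMod p × ZMod p) × Finset (ZMod p × ZMod p) :=
    fun e => (f ∘ e, Finset.univ.image (g ∘ e))
  let K := (Fin k → ZMod p × ZMod p) × Finset (ZMod p × ZMod p)
  have hK : Fintype.card K = (p ^ 2) ^ k * 2 ^ (p ^ 2) := by
    simp only [K, Fintype.card_prod, Fintype.card_fun, Fintype.card_finset, ZMod.card, Fintype.card_fin]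
    ring_nf
  obtain ⟨q, hq⟩ : ∃ q : K, p ^ k ≤ (S.filter fun e => key e = q).card * (2 ^ (p ^ 2) * 3 ^ k) := by
    by_contra! hcon
    have h1 : S.card = ∑ q : K, (S.filter fun e => key e = q).card :=
      Finset.card_eq_sum_card_fiberwise (by simp)
    have h2 : S.card * (2 ^ (p ^ 2) * 3 ^ k) < Fintype.card K * p ^ k := by
      rw [h1, Finset.sum_mul]
      calc _ < ∑ q : K, p ^ k := Finset.sum_lt_sum_of_nonempty ⟨(fun _ => 0, ∅), by simp⟩ (fun q _ => hcon q)
        _ = _ := by simp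
    have h3 : (p ^ 2) ^ k * p ^ k ≤ (p ^ 3 - 2 * p * k) ^ k * 3 ^ k := by
      rw [← mul_pow, ← mul_pow]
      apply Nat.pow_le_pow_left
      have : p ^ 3 - 2 * p * k = p * (p ^ 2 - 2 * k) := by
        rw [Nat.mul_sub]; congr 1 <;> ring
      rw [this]
      have : p ^ 2 ≤ (p ^ 2 - 2 * k) * 3 := by omega
      calc p ^ 2 * p = p * p ^ 2 := by ring
        _ ≤ p * ((p ^ 2 - 2 * k) * 3) := by gcongr
        _ = _ := by ring
    rw [hK] at h2
    have h4 : (p ^ 3 - 2 * p * k) ^ k * 3 ^ k * 2 ^ (p ^ 2) ≤ S.card * (2 ^ (p ^ 2) * 3 ^ k) := by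
      calc _ = (p ^ 3 - 2 * p * k) ^ k * (2 ^ (p ^ 2) * 3 ^ k) := by ring
        _ ≤ _ := by gcongr
    have h5 := Nat.mul_le_mul_right (2 ^ (p ^ 2)) h3
    nlinarith
  obtain ⟨s, T⟩ := q
  have hmem : ∀ e ∈ (S.filter fun e => key e = (s, T)), Function.Injective (f ∘ e) ∧
      Function.Injective (g ∘ e) ∧ f ∘ e = s ∧ Finset.univ.image (g ∘ e) = T := by
    intro e he
    simp only [Finset.mem_filter, hS, Finset.mem_univ, true_and, key, Prod.mk.injEq] at he
    tauto
  have hne : (S.filter fun e => key e = (s, T)).Nonempty := by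
    rw [← Finset.card_pos]
    by_contra h0
    have : 0 < p ^ k := by positivity
    have h0 : (S.filter fun e => key e = (s, T)).card = 0 := by omega
    rw [h0] at hq; omega
  obtain ⟨e0, he0⟩ := hne
  obtain ⟨hi1, hi2, hs, hT⟩ := hmem e0 he0
  have hTc : T.card = k := by
    rw [← hT, Finset.card_image_of_injective _ hi2]; simp
  let t : Fin k ≃ T := (T.equivFinOfCardEq hTc).symm
  have hgT : ∀ e ∈ (S.filter fun e => key e = (s, T)), ∀ i, g (e i) ∈ T := by
    intro e he i
    rw [← (hmem e he).2.2.2]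
    exact Finset.mem_image_of_mem (g ∘ e) (Finset.mem_univ i)
  let Q := {e // e ∈ (S.filter fun e => key e = (s, T))}
  let π : Q → Equiv.Perm (Fin k) := fun e =>
    Equiv.ofBijective (fun i => t.symm ⟨g (e.1 i), hgT e.1 e.2 i⟩) (by
      rw [← Finite.injective_iff_bijective]
      intro i j hij
      have := t.symm.injective hij
      simp only [Subtype.mk.injEq] at this
      exact (hmem e.1 e.2).2.1 this)
  have hπ : ∀ e i, (t (π e i) : ZMod p × ZMod p) = g (e.1 i) := by
    intro e i; simp [π]
  have hπi : Function.Injective π := by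
    intro e e' h
    apply Subtype.ext
    funext i
    apply hfg
    · exact congrFun ((hmem e.1 e.2).2.2.1.trans (hmem e'.1 e'.2).2.2.1.symm) i
    · rw [← hπ, ← hπ, h]
  refine ⟨fun i j => ∃ e : E, f e = s i ∧ g e = t j, Finset.univ.image π, ?_, ?_, ?_⟩
  · rintro a a' b b' ⟨⟨⟨x, y⟩, m⟩, h1, h1'⟩ ⟨⟨⟨x2, y2⟩, m'⟩, h2, h2'⟩ ⟨⟨⟨x', y'⟩, m2⟩, h3, h3'⟩
      ⟨⟨⟨x2', y2'⟩, m2'⟩, h4, h4'⟩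
    have e1 := h1.trans h2.symm
    have e2 := h3.trans h4.symm
    have e3 := h1'.trans h3'.symm
    have e4 := h2'.trans h4'.symm
    simp only [f, g, Prod.mk.injEq] at e1 e2 e3 e4
    obtain ⟨rfl, rfl⟩ := e1
    obtain ⟨rfl, rfl⟩ := e2
    obtain ⟨rfl, e3⟩ := e3
    obtain ⟨rfl, e4⟩ := e4
    have h0 : (m - m') * (x - x') = 0 := by linear_combination e4 - e3
    rcases mul_eq_zero.mp h0 with h | h
    · right
      have : m = m' := sub_eq_zero.mp h
      subst this
      exact t.injective (Subtype.ext (h1'.symm.trans h2'))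
    · left
      have : x = x' := sub_eq_zero.mp h
      subst this
      have hy : y = y' := by linear_combination e3
      subst hy
      have : s a = s a' := h1.symm.trans h3
      rw [← hs] at this
      exact hi1 this
  · intro σ hσ i
    obtain ⟨e, _, rfl⟩ := Finset.mem_image.mp hσ
    exact ⟨e.1 i, congrFun (hmem e.1 e.2).2.2.1 i, (hπ e i).symm⟩
  · rw [Finset.card_image_of_injective _ hπi]
    simpa [Q] using hq

theorem key (k : ℕ) (hk : 1 ≤ k) :
    ∃ (R : Fin k → Fin k → Prop) (P : Finset (Equiv.Perm (Fin k))), RelC4Free R ∧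
      (∀ π ∈ P, ∀ i, R i (π i)) ∧ k ^ k ≤ P.card ^ 2 * (2 ^ 100) ^ k := by
  set s := Nat.sqrt (3 * k) + 1 with hs
  obtain ⟨p, hp, h1, h2⟩ := Nat.exists_prime_lt_and_le_two_mul s (by omega)
  have : Fact p.Prime := ⟨hp⟩
  have h3 : 3 * k < s * s := Nat.sqrt_lt.mp (by omega)
  have h4 : Nat.sqrt (3 * k) * Nat.sqrt (3 * k) ≤ 3 * k := Nat.sqrt_le _
  have h5 : 1 ≤ Nat.sqrt (3 * k) := Nat.le_sqrt.mpr (by omega)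
  have h6 : s * s ≤ 12 * k := by nlinarith
  have h7 : 3 * k ≤ p ^ 2 := by nlinarith
  have h8 : p ^ 2 ≤ 48 * k := by nlinarith
  obtain ⟨R, P, hR, hP, hc⟩ := key_prime p k h7
  refine ⟨R, P, hR, hP, ?_⟩
  calc k ^ k ≤ (p ^ 2) ^ k := by gcongr; omega
    _ = (p ^ k) ^ 2 := by rw [← pow_mul, ← pow_mul, mul_comm]
    _ ≤ (P.card * (2 ^ (p ^ 2) * 3 ^ k)) ^ 2 := by gcongr
    _ ≤ (P.card * (2 ^ (48 * k) * 4 ^ k)) ^ 2 := by gcongr <;> norm_num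
    _ = P.card ^ 2 * (2 ^ 100) ^ k := by
      rw [mul_pow]; congr 1
      rw [show (4:ℕ) = 2 ^ 2 by norm_num]
      simp only [← pow_mul, ← pow_add]
      congr 1; ring

/-- pairwise form of containing a four-cycle -/
def Four {V : Type*} (G : SimpleGraph V) : Prop :=
  ∃ a b c d, a ≠ c ∧ b ≠ d ∧ G.Adj a b ∧ G.Adj b c ∧ G.Adj c d ∧ G.Adj d a

theorem four_of_cycle {V : Type*} (G : SimpleGraph V) (h : ContainsCycleLen G 4) : Four G := by
  obtain ⟨u, w, hc, hl⟩ := h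
  match w, hc, hl with
  | .cons (v := v1) h1 (.cons (v := v2) h2 (.cons (v := v3) h3 (.cons h4 .nil))), hc, _ =>
    have := hc.support_nodup
    simp at this
    refine ⟨u, v1, v2, v3, ?_, ?_, h1, h2, h3, h4⟩ <;> grind

/-- oriented layered step relation -/
def stepRel {V : Type*} (L : ℕ) (t i : V → ℕ) (S W : ℕ → ℕ → Prop) (u v : V) : Prop :=
  (t u % 2 = 0 ∧ t v = t u + 1 ∧ i u = i v) ∨
  (t u % 2 = 1 ∧ t u + 1 < 2 * L ∧ t v = t u + 1 ∧ S (i u) (i v)) ∨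
  (t u + 1 = 2 * L ∧ t v = 0 ∧ W (i u) (i v))

theorem step_layer {V : Type*} {L : ℕ} {t i : V → ℕ} {S W : ℕ → ℕ → Prop}
    {u v : V} (h : stepRel L t i S W u v) :
    (t v = t u + 1 ∧ t u + 1 < 2 * L ∨ t v = 0 ∧ t u + 1 = 2 * L) ∨ (t u % 2 = 0 ∧ t v = t u + 1) := by
  rcases h with h | h | h
  · right; exact ⟨h.1, h.2.1⟩
  · left; left; exact ⟨h.2.2.1, h.2.1⟩
  · left; right; exact ⟨h.2.1, h.1⟩

theorem step_even {V : Type*} {L : ℕ} {t i : V → ℕ} {S W : ℕ → ℕ → Prop}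
    (hinj : ∀ u v, t u = t v → i u = i v → u = v)
    {x y x' y' : V} (h : stepRel L t i S W x y) (h' : stepRel L t i S W x' y')
    (he : t x % 2 = 0) (htx : t x = t x') (hi : x = x' ∨ y = y') : x = x' ∧ y = y' := by
  rcases h with h | h | h <;> rcases h' with h' | h' | h' <;> try omega
  have h1 : i x = i x' := by
    rcases hi with rfl | rfl
    · rfl
    · omega
  exact ⟨hinj _ _ htx h1, hinj _ _ (by omega) (by omega)⟩

theorem step_D {V : Type*} {L : ℕ} {t i : V → ℕ} {S W : ℕ → ℕ → Prop}
    (ht : ∀ v, t v < 2 * L) (hinj : ∀ u v, t u = t v → i u = i v → u = v)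
    {x y z w : V} (h1 : stepRel L t i S W x y) (h2 : stepRel L t i S W y z)
    (h3 : stepRel L t i S W x w) (h4 : stepRel L t i S W w z) : y = w := by
  have a1 := step_layer h1
  have a2 := step_layer h2
  have a3 := step_layer h3
  have a4 := step_layer h4
  have := ht x; have := ht y; have := ht z; have := ht w
  by_cases he : t x % 2 = 0
  · exact (step_even hinj h1 h3 he rfl (Or.inl rfl)).2
  · exact (step_even hinj h2 h4 (by omega) (by omega) (Or.inr rfl)).1

theorem step_B {V : Type*} {L : ℕ} {t i : V → ℕ} {S W : ℕ → ℕ → Prop}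
    (ht : ∀ v, t v < 2 * L) (hinj : ∀ u v, t u = t v → i u = i v → u = v) (hS : RelC4Free S) (hW1 : ∀ a b b', W a b → W a b' → b = b')
    {x x' y y' : V} (h1 : stepRel L t i S W x y) (h2 : stepRel L t i S W x y')
    (h3 : stepRel L t i S W x' y) (h4 : stepRel L t i S W x' y') : x = x' ∨ y = y' := by
  by_cases he : t x % 2 = 0
  · exact Or.inr (step_even hinj h1 h2 he rfl (Or.inl rfl)).2
  have := ht x; have := ht y; have := ht x'; have := ht y'
  rcases h1 with h1 | h1 | h1 <;> rcases h2 with h2 | h2 | h2 <;> try omega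
  · rcases h3 with h3 | h3 | h3 <;> rcases h4 with h4 | h4 | h4 <;> try omega
    rcases hS _ _ _ _ h1.2.2.2 h2.2.2.2 h3.2.2.2 h4.2.2.2 with h | h
    · left; exact hinj _ _ (by omega) h
    · right; exact hinj _ _ (by omega) h
  · right
    exact hinj _ _ (by omega) (hW1 _ _ _ h1.2.2 h2.2.2)

theorem layered_not_four {V : Type*} {L : ℕ} {t i : V → ℕ} {S W : ℕ → ℕ → Prop}
    (hL : 3 ≤ L) (ht : ∀ v, t v < 2 * L) (hinj : ∀ u v, t u = t v → i u = i v → u = v) (hS : RelC4Free S) (hW1 : ∀ a b b', W a b → W a b' → b = b')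
    (G : SimpleGraph V)
    (hG : ∀ u v, G.Adj u v → stepRel L t i S W u v ∨ stepRel L t i S W v u) : ¬ Four G := by
  rintro ⟨a, b, c, d, hac, hbd, h1, h2, h3, h4⟩
  have la := ht a; have lb := ht b; have lc := ht c; have ld := ht d
  rcases hG _ _ h1 with h1 | h1 <;> rcases hG _ _ h2 with h2 | h2 <;>
    rcases hG _ _ h3 with h3 | h3 <;> rcases hG _ _ h4 with h4 | h4 <;>
    have a1 := step_layer h1 <;> have a2 := step_layer h2 <;> have a3 := step_layer h3 <;>
    have a4 := step_layer h4 <;>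
    first
    | (exfalso; omega)
    | exact hbd (step_D ht hinj h1 h2 h4 h3)
    | exact hac (step_D ht hinj h4 h1 h3 h2)
    | exact hbd (step_D ht hinj h2 h1 h3 h4)
    | exact hac (step_D ht hinj h1 h4 h2 h3)
    | exact (step_B ht hinj hS hW1 h1 h4 h2 h3).elim hac hbd
    | exact (step_B ht hinj hS hW1 h1 h2 h4 h3).elim hbd hac

/-- extension of a relation on `Fin k` by one isolated edge -/
def hatR {k : ℕ} (R : Fin k → Fin k → Prop) (i j : ℕ) : Prop :=
  (∃ hi : i < k, ∃ hj : j < k, R ⟨i, hi⟩ ⟨j, hj⟩) ∨ (k ≤ i ∧ i = j)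

theorem hatR_free {k : ℕ} (R : Fin k → Fin k → Prop) (h : RelC4Free R) : RelC4Free (hatR R) := by
  rintro a a' b b' (⟨h1, h1', r1⟩ | h1) (⟨h2, h2', r2⟩ | h2) (⟨h3, h3', r3⟩ | h3) (⟨h4, h4', r4⟩ | h4)
    <;> try omega
  rcases h _ _ _ _ r1 r2 r3 r4 with h | h
  · left; simpa using h
  · right; simpa using h

/-- extension of a permutation -/
noncomputable def extP {k : ℕ} (σ : Equiv.Perm (Fin k)) : Equiv.Perm ℕ :=
  σ.extendDomain Fin.equivSubtype

theorem ext_lt {k : ℕ} (σ : Equiv.Perm (Fin k)) (i : ℕ) (hi : i < k) :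
    extP σ i = σ ⟨i, hi⟩ := by
  rw [extP, Equiv.Perm.extendDomain_apply_subtype σ Fin.equivSubtype (b := i) hi]
  rfl

theorem ext_ge {k : ℕ} (σ : Equiv.Perm (Fin k)) (i : ℕ) (hi : k ≤ i) :
    extP σ i = i := by
  rw [extP, Equiv.Perm.extendDomain_apply_not_subtype _ _ (by omega)]

/-- cumulative products -/
def rho {k m : ℕ} (π : Fin m → Equiv.Perm (Fin k)) : ℕ → Equiv.Perm (Fin k)
  | 0 => 1
  | s + 1 => (if h : s < m then π ⟨s, h⟩ else 1) * rho π s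

/-- vertex at a given position -/
noncomputable def phi {k m : ℕ} (L : ℕ) (π : Fin m → Equiv.Perm (Fin k)) (v : ℕ) : ℕ :=
  2 * L * extP (rho π (v % (2 * L) / 2)) (v / (2 * L)) + v % (2 * L)

theorem phi_mod {k m : ℕ} (L : ℕ) (π : Fin m → Equiv.Perm (Fin k)) (v : ℕ) :
    phi L π v % (2 * L) = v % (2 * L) := by
  simp [phi]

theorem phi_div {k m : ℕ} (L : ℕ) (hL : 3 ≤ L) (π : Fin m → Equiv.Perm (Fin k)) (v : ℕ) :
    phi L π v / (2 * L) = extP (rho π (v % (2 * L) / 2)) (v / (2 * L)) := by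
  rw [phi, Nat.mul_add_div (by omega), Nat.div_eq_of_lt (Nat.mod_lt _ (by omega))]
  rfl

theorem phi_lt {m : ℕ} (n L : ℕ) (hL : 3 ≤ L) (π : Fin m → Equiv.Perm (Fin (n / (2 * L)))) (v : ℕ)
    (hv : v < n) : phi L π v < n := by
  by_cases h : v / (2 * L) < n / (2 * L)
  · have h1 : phi L π v / (2 * L) < n / (2 * L) := by
      rw [phi_div L hL, ext_lt _ _ h]; exact Fin.is_lt _
    by_contra h2
    have := Nat.div_le_div_right (c := 2 * L) (not_lt.mp h2)
    omega
  · have : phi L π v = v := by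
      rw [phi, ext_ge _ _ (by omega), Nat.div_add_mod]
    omega

theorem phi_inj {k m : ℕ} (L : ℕ) (hL : 3 ≤ L) (π : Fin m → Equiv.Perm (Fin k)) :
    Function.Injective (phi L π) := by
  intro u v h
  have h1 := phi_mod L π u
  have h2 := phi_div L hL π u
  rw [h, phi_mod] at h1
  rw [h, phi_div L hL, ← h1] at h2
  have h3 := (extP _).injective h2
  rw [← Nat.div_add_mod u (2 * L), ← Nat.div_add_mod v (2 * L), h1, h3]

theorem phi_step {k L : ℕ} (hL : 3 ≤ L) (R : Fin k → Fin k → Prop)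
    (π : Fin (L - 1) → Equiv.Perm (Fin k)) (hπ : ∀ s i, R i (π s i)) (v : ℕ) :
    stepRel L (fun x => x % (2 * L)) (fun x => x / (2 * L)) (hatR R)
      (fun a b => ∃ c, a = extP (rho π (L - 1)) c ∧ b = c + 1) (phi L π v) (phi L π (v + 1)) := by
  unfold stepRel
  simp only [phi_mod, phi_div L hL]
  have hm := Nat.mod_lt v (show 2 * L > 0 by omega)
  have hd := Nat.div_add_mod v (2 * L)
  by_cases hlast : v % (2 * L) + 1 = 2 * L
  · right; right
    have e : v + 1 = 2 * L * (v / (2 * L) + 1) := by rw [mul_add]; omega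
    have e1 : (v + 1) % (2 * L) = 0 := by rw [e]; simp
    have e2 : (v + 1) / (2 * L) = v / (2 * L) + 1 := by
      rw [e, Nat.mul_div_cancel_left _ (by omega)]
    refine ⟨hlast, e1, v / (2 * L), ?_, ?_⟩
    · congr 3; omega
    · rw [e1, e2]
      simp only [Nat.zero_div, rho]
      by_cases h : v / (2 * L) + 1 < k
      · rw [ext_lt _ _ h]; rfl
      · rw [ext_ge _ _ (by omega)]
  · have e : v + 1 = 2 * L * (v / (2 * L)) + (v % (2 * L) + 1) := by omega
    have e1 : (v + 1) % (2 * L) = v % (2 * L) + 1 := by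
      rw [e, Nat.mul_add_mod, Nat.mod_eq_of_lt (by omega)]
    have e2 : (v + 1) / (2 * L) = v / (2 * L) := by
      conv_lhs => rw [e]
      rw [Nat.mul_add_div (by omega), Nat.div_eq_of_lt (a := v % (2 * L) + 1) (by omega)]; rfl
    rw [e1, e2]
    rcases Nat.mod_two_eq_zero_or_one (v % (2 * L)) with h | h
    · left
      refine ⟨h, rfl, ?_⟩
      congr 3; omega
    · right; left
      refine ⟨h, by omega, rfl, ?_⟩
      have : (v % (2 * L) + 1) / 2 = v % (2 * L) / 2 + 1 := by omega
      rw [this, rho, dif_pos (by omega)]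
      by_cases hk : v / (2 * L) < k
      · left
        rw [ext_lt _ _ hk, ext_lt _ _ hk]
        refine ⟨Fin.is_lt _, Fin.is_lt _, ?_⟩
        exact hπ _ _
      · right
        rw [ext_ge _ _ (by omega), ext_ge _ _ (by omega)]
        omega

theorem phi_recover {n L : ℕ} (hL : 3 ≤ L) 
    (π π' : Fin (L - 1) → Equiv.Perm (Fin (n / (2 * L)))) (h : ∀ v < n, phi L π v = phi L π' v) :
    π = π' := by
  have h1 : ∀ s, s < L → rho π s = rho π' s := by
    intro s hs
    ext i
    have hv : 2 * L * i + 2 * s < n := by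
      have := i.2
      have h2 : (2 * L) * (i + 1) ≤ (2 * L) * (n / (2 * L)) := by gcongr; omega
      have := Nat.mul_div_le n (2 * L)
      rw [mul_add] at h2
      omega
    have e1 : (2 * L * i + 2 * s) % (2 * L) = 2 * s := by
      rw [Nat.mul_add_mod, Nat.mod_eq_of_lt (by omega)]
    have e2 : (2 * L * i + 2 * s) / (2 * L) = i := by
      rw [Nat.mul_add_div (by omega), Nat.div_eq_of_lt (a := 2 * s) (by omega)]; rfl
    have := congrArg (· / (2 * L)) (h _ hv)
    simp only [phi_div L hL, e1, e2] at this
    rw [ext_lt _ _ i.2, ext_lt _ _ i.2] at this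
    simpa using this
  funext s
  have a := h1 (s + 1) (by omega)
  rw [rho, rho, h1 s (by omega), dif_pos s.2, dif_pos s.2] at a
  exact mul_right_cancel a

theorem main_count {n L : ℕ} (hL : 3 ≤ L) (R : Fin (n / (2 * L)) → Fin (n / (2 * L)) → Prop)
    (hR : RelC4Free R) (P : Finset (Equiv.Perm (Fin (n / (2 * L)))))
    (hP : ∀ π ∈ P, ∀ i, R i (π i)) (F : Finset (SimpleGraph (Fin n)))
    (hF : ∀ G ∈ F, IsHamPathGraph G)
    (hFF : ∀ G₁ ∈ F, ∀ G₂ ∈ F, G₁ ≠ G₂ → ContainsCycleLen (G₁ ⊔ G₂) 4) :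
    F.card * P.card ^ (L - 1) ≤ n.factorial * (n / (2 * L)).factorial := by
  classical
  have hF' : ∀ G : F, IsHamPathGraph G.1 := fun G => hF G.1 G.2
  choose σ hσ using hF'
  let Φ : (Fin (L - 1) → P) → Equiv.Perm (Fin n) := fun π =>
    Equiv.ofBijective (fun v => ⟨phi L (fun s => (π s).1) v, phi_lt n L hL _ v v.2⟩) (by
      rw [← Finite.injective_iff_bijective]
      intro u v h
      simp only [Fin.mk.injEq] at h
      exact Fin.ext (phi_inj L hL _ h))
  have hΦ : ∀ π v, (Φ π v : ℕ) = phi L (fun s => (π s).1) v := fun π v => rfl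
  -- the map `Φ π ∘ σ G` carries `G` into the layered graph
  let J : F × (Fin (L - 1) → P) → Equiv.Perm (Fin n) × Equiv.Perm (Fin (n / (2 * L))) := fun x =>
    ((σ x.1).trans (Φ x.2), rho (fun s => (x.2 s).1) (L - 1))
  have hJ : Function.Injective J := by
    rintro ⟨G, π⟩ ⟨G', π'⟩ h
    simp only [J, Prod.mk.injEq] at h
    obtain ⟨h1, h2⟩ := h
    have hGG : G = G' := by
      by_contra hne
      have h4 := four_of_cycle _ (hFF G.1 G.2 G'.1 G'.2 (fun h => hne (Subtype.ext h)))
      set g := (σ G).trans (Φ π) with hg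
      let rel := fun a b : ℕ => ∃ c, a = extP (rho (fun s => (π s).1) (L - 1)) c ∧ b = c + 1
      refine layered_not_four (V := Fin n) (L := L) (t := fun x => (g x : ℕ) % (2 * L))
        (i := fun x => (g x : ℕ) / (2 * L)) (S := hatR R) (W := rel) hL
        (fun v => Nat.mod_lt _ (by omega)) ?_ (hatR_free R hR) ?_ (G.1 ⊔ G'.1) ?_ h4
      · intro u v e1 e2
        apply g.injective
        apply Fin.ext
        rw [← Nat.div_add_mod (g u) (2 * L), ← Nat.div_add_mod (g v) (2 * L), e1, e2]
      · rintro a b b' ⟨c, hc, rfl⟩ ⟨c', hc', rfl⟩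
        rw [hc] at hc'
        rw [(extP _).injective hc']
      · have hall : ∀ (G'' : F) (π'' : Fin (L - 1) → P), g = (σ G'').trans (Φ π'') →
            rho (fun s => (π s).1) (L - 1) = rho (fun s => (π'' s).1) (L - 1) →
            ∀ u v, (σ G'' u : ℕ) + 1 = σ G'' v →
            stepRel L (fun x => (g x : ℕ) % (2 * L)) (fun x => (g x : ℕ) / (2 * L)) (hatR R) rel u v := by
          intro G'' π'' e1 e2 u v huv
          have := phi_step hL R (fun s => (π'' s).1) (fun s i => hP _ (π'' s).2 i) (σ G'' u)
          rw [huv, ← e2, ← hΦ, ← hΦ] at this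
          rw [e1]
          exact this
        intro u v huv
        rcases huv with huv | huv
        · rw [hσ G, SimpleGraph.pathGraph_adj] at huv
          rcases huv with h | h
          · exact Or.inl (hall G π rfl rfl _ _ h)
          · exact Or.inr (hall G π rfl rfl _ _ h)
        · rw [hσ G', SimpleGraph.pathGraph_adj] at huv
          rcases huv with h | h
          · exact Or.inl (hall G' π' h1 h2 _ _ h)
          · exact Or.inr (hall G' π' h1 h2 _ _ h)
    subst hGG
    have hΦΦ : ∀ v, Φ π v = Φ π' v := by
      intro v
      have := congrArg (fun e => e ((σ G).symm v)) h1
      simpa using this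
    have := phi_recover hL (fun s => (π s).1) (fun s => (π' s).1) (fun v hv => by
      have := congrArg Fin.val (hΦΦ ⟨v, hv⟩)
      simpa [hΦ] using this)
    have : π = π' := by
      funext s
      exact Subtype.ext (congrFun this s)
    rw [this]
  have := Fintype.card_le_of_injective J hJ
  simpa [Fintype.card_perm] using this

theorem Hnum_mem (n k : ℕ) : ∃ F : Finset (SimpleGraph (Fin n)), F.card = Hnum n k ∧
    (∀ G ∈ F, IsHamPathGraph G) ∧
    ∀ G₁ ∈ F, ∀ G₂ ∈ F, G₁ ≠ G₂ → ContainsCycleLen (G₁ ⊔ G₂) k := by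
  classical
  have := Nat.sSup_mem (s := {m | ∃ F : Finset (SimpleGraph (Fin n)), F.card = m ∧
    (∀ G ∈ F, IsHamPathGraph G) ∧
    ∀ G₁ ∈ F, ∀ G₂ ∈ F, G₁ ≠ G₂ → ContainsCycleLen (G₁ ⊔ G₂) k})
    ⟨0, ∅, by simp⟩ ⟨Fintype.card (SimpleGraph (Fin n)), by
      rintro m ⟨F, rfl, _⟩
      exact Finset.card_le_univ F⟩
  exact this

theorem nat_bound {n L : ℕ} (hL : 3 ≤ L) (hn : 2 * L ≤ n) :
    (Hnum n 4) ^ 2 * (n / (2 * L)) ^ ((n / (2 * L)) * (L - 3)) ≤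
      n ^ (2 * n) * (2 ^ 100) ^ ((n / (2 * L)) * (L - 1)) := by
  obtain ⟨F, hFc, hF, hFF⟩ := Hnum_mem n 4
  set k := n / (2 * L) with hk
  have hk1 : 1 ≤ k := (Nat.one_le_div_iff (by omega)).mpr hn
  obtain ⟨R, P, hR, hP, hc⟩ := key k hk1
  have hm := main_count hL R hR P hP F hF hFF
  rw [hFc] at hm
  change _ ≤ n.factorial * k.factorial at hm
  set H := Hnum n 4
  have h1 : H * P.card ^ (L - 1) ≤ n ^ n * k ^ k :=
    hm.trans (Nat.mul_le_mul (Nat.factorial_le_pow n) (Nat.factorial_le_pow k))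
  have h2 : (k ^ k) ^ (L - 1) ≤ (P.card ^ 2 * (2 ^ 100) ^ k) ^ (L - 1) := Nat.pow_le_pow_left hc _
  have h3 : (k ^ k) ^ (L - 1) = k ^ (k * (L - 3)) * (k ^ k) ^ 2 := by
    rw [← pow_mul, ← pow_mul, ← pow_add, ← mul_add]; congr 2; omega
  have hpos : 0 < (k ^ k) ^ 2 := by positivity
  refine Nat.le_of_mul_le_mul_right ?_ hpos
  calc H ^ 2 * k ^ (k * (L - 3)) * (k ^ k) ^ 2 = H ^ 2 * (k ^ k) ^ (L - 1) := by rw [h3]; ring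
    _ ≤ H ^ 2 * (P.card ^ 2 * (2 ^ 100) ^ k) ^ (L - 1) := Nat.mul_le_mul_left _ h2
    _ = (H * P.card ^ (L - 1)) ^ 2 * (2 ^ 100) ^ (k * (L - 1)) := by
      simp only [mul_pow, ← pow_mul, mul_comm, mul_left_comm, mul_assoc]
    _ ≤ (n ^ n * k ^ k) ^ 2 * (2 ^ 100) ^ (k * (L - 1)) :=
      Nat.mul_le_mul_right _ (Nat.pow_le_pow_left h1 2)
    _ = _ := by
      rw [mul_pow, ← pow_mul n, mul_comm n 2]; ring

/-- Cohen–Fachini–Körner upper bound: `H(n,4) ≤ n^((3/4)n - o(n))`. -/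
theorem stmt_4 :
    ∀ ε : ℝ, 0 < ε → ∃ N : ℕ, ∀ n : ℕ, N ≤ n →
      (Hnum n 4 : ℝ) ≤ (n : ℝ) ^ ((3 / 4 + ε) * n) := by
  intro ε hε
  obtain ⟨L0, hL0⟩ := exists_nat_gt (3 / (2 * ε))
  set L := max L0 3 with hLdef
  have hL : 3 ≤ L := le_max_right _ _
  have hLε : 3 / (2 * ε) < (L : ℝ) := hL0.trans_le (by exact_mod_cast le_max_left _ _)
  have hLpos : (0 : ℝ) < L := by positivity
  have hLε' : 3 ≤ 2 * ε * L := by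
    rw [div_lt_iff₀ (by positivity)] at hLε; nlinarith
  set c : ℝ := Real.log (4 * L) + Real.log (2 ^ 100) with hc
  obtain ⟨N1, hN1⟩ := exists_nat_gt (2 * L / ε)
  obtain ⟨N2, hN2⟩ := exists_nat_gt (Real.exp (2 * c / ε))
  refine ⟨max (4 * L) (max N1 N2), fun n hn => ?_⟩
  have hn1 : 4 * L ≤ n := (le_max_left _ _).trans hn
  have hn2 : N1 ≤ n := (le_max_left _ _).trans ((le_max_right _ _).trans hn)
  have hn3 : N2 ≤ n := (le_max_right _ _).trans ((le_max_right _ _).trans hn)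
  have hnpos : (0 : ℝ) < n := by
    have : 0 < n := by omega
    exact_mod_cast this
  rcases Nat.eq_zero_or_pos (Hnum n 4) with h0 | hpos
  · rw [h0]; simp only [Nat.cast_zero]; positivity
  have hb := nat_bound hL (show 2 * L ≤ n by omega)
  set k := n / (2 * L) with hk
  have hk1 : 1 ≤ k := (Nat.one_le_div_iff (by omega)).mpr (by omega)
  have hkpos : (0 : ℝ) < k := by exact_mod_cast hk1
  set H := Hnum n 4
  have hHpos : (0 : ℝ) < H := by exact_mod_cast hpos
  have hlt : n < 2 * L * (k + 1) := by
    have := Nat.lt_mul_div_succ n (show 0 < 2 * L by omega); simpa [hk] using this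
  have hle : 2 * L * k ≤ n := Nat.mul_div_le n (2 * L)
  have hltR : (n : ℝ) < 2 * L * (k + 1) := by exact_mod_cast hlt
  have hleR : 2 * L * k ≤ (n : ℝ) := by exact_mod_cast hle
  have hbR : (H : ℝ) ^ 2 * (k : ℝ) ^ (k * (L - 3)) ≤ (n : ℝ) ^ (2 * n) * (2 ^ 100) ^ (k * (L - 1)) := by
    exact_mod_cast hb
  have hlog := Real.log_le_log (by positivity) hbR
  rw [Real.log_mul (by positivity) (by positivity), Real.log_mul (by positivity) (by positivity),
    Real.log_pow, Real.log_pow, Real.log_pow, Real.log_pow] at hlog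
  push_cast [Nat.cast_sub hL, Nat.cast_sub (show 1 ≤ L by omega)] at hlog
  have hlc : 0 ≤ Real.log (2 ^ 100) := Real.log_nonneg (by norm_num)
  have hl4 : 0 ≤ Real.log (4 * L) := Real.log_nonneg (by
    have : (3 : ℝ) ≤ L := by exact_mod_cast hL
    linarith)
  have hL3 : (3 : ℝ) ≤ L := by exact_mod_cast hL
  have hn1R : (4 * L : ℝ) ≤ n := by exact_mod_cast hn1
  have hlk : Real.log n - Real.log (4 * L) ≤ Real.log k := by
    rw [← Real.log_div (by positivity) (by positivity)]
    apply Real.log_le_log (by positivity)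
    rw [div_le_iff₀ (by positivity)]
    nlinarith
  have hlnc : 2 * c / ε ≤ Real.log n := by
    rw [Real.le_log_iff_exp_le hnpos]
    exact hN2.le.trans (by exact_mod_cast hn3)
  have hlnc' : 2 * c ≤ ε * Real.log n := by
    rw [div_le_iff₀ hε] at hlnc; linarith
  have hLn : 2 * L ≤ ε * n := by
    have : 2 * L / ε ≤ (n : ℝ) := hN1.le.trans (by exact_mod_cast hn2)
    rw [div_le_iff₀ hε] at this; linarith
  have hlnn : 0 ≤ Real.log n := Real.log_nonneg (by linarith)
  rw [Real.le_rpow_iff_log_le hHpos hnpos]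
  set ln := Real.log n
  set lk := Real.log k
  set l4 := Real.log (4 * L)
  set lC := Real.log ((2 : ℝ) ^ 100)
  -- k (L-3) lk ≥ k (L-3) ln - k (L-3) l4
  have s1 : k * (L - 3) * (ln - l4) ≤ (k : ℝ) * (L - 3) * lk := by
    have : (0 : ℝ) ≤ k * (L - 3) := by
      apply mul_nonneg hkpos.le; linarith
    gcongr
  have hkL : (k : ℝ) * L ≤ n / 2 := by linarith
  have s2 : (k : ℝ) * (L - 3) * l4 ≤ n * l4 := by
    apply mul_le_mul_of_nonneg_right _ hl4
    linarith
  have s3 : (k : ℝ) * (L - 1) * lC ≤ n * lC := by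
    apply mul_le_mul_of_nonneg_right _ hlc
    linarith
  have hk3 : 3 * (k : ℝ) ≤ ε * n := by
    have u1 := mul_le_mul_of_nonneg_right hLε' hkpos.le
    have u2 := mul_le_mul_of_nonneg_left hleR hε.le
    linarith
  have s4 : (n / 2 - L - ε * n) * ln ≤ (k : ℝ) * (L - 3) * ln := by
    apply mul_le_mul_of_nonneg_right _ hlnn
    linarith
  have s5 : n * (2 * c) ≤ n * (ε * ln) := by gcongr
  have s6 : 2 * L * ln ≤ ε * n * ln := by gcongr
  rw [hc] at s5
  ring_nf at s1 s2 s3 s4 s5 s6 hlog ⊢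
  linarith
end

section
/- For every integer k ≥ 2, H(n,2k) ≤ n^{(1 − 2/(3k² − 2k))n − o(n)}; precisely, for every ε > 0 there exists N such that for all n ≥ N, H(n,2k) ≤ n^{(1 − 2/(3k² − 2k) + ε)n}. -/
open SimpleGraph

open Classical in
lemma hp_acyclic {n : ℕ} {H : SimpleGraph (Fin n)} (h : IsHamPathGraph H) : H.IsAcyclic := by
  obtain ⟨σ, hσ⟩ := h
  intro u w hw
  obtain ⟨x, hx, hmax⟩ := Finset.exists_max_image w.support.toFinset (fun a => (σ a).val)
    ⟨u, by simp⟩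
  rw [List.mem_toFinset] at hx
  have hr := hw.rotate hx
  have hne := hr.snd_ne_penultimate
  have hnn : ¬ (w.rotate x hx).Nil := hr.not_nil
  have h1 := (w.rotate x hx).adj_snd hnn
  have h2 := (w.rotate x hx).adj_penultimate hnn
  have m1 : (w.rotate x hx).snd ∈ w.support := by
    rw [← SimpleGraph.Walk.mem_support_rotate_iff w]
    exact SimpleGraph.Walk.getVert_mem_support _ _
  have m2 : (w.rotate x hx).penultimate ∈ w.support := by
    rw [← SimpleGraph.Walk.mem_support_rotate_iff w]
    exact SimpleGraph.Walk.getVert_mem_support _ _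
  have l1 := hmax _ (List.mem_toFinset.2 m1)
  have l2 := hmax _ (List.mem_toFinset.2 m2)
  rw [hσ, pathGraph_adj] at h1 h2
  apply hne
  apply σ.injective
  apply Fin.ext
  omega

open Classical in
lemma hp_degree {n : ℕ} {H : SimpleGraph (Fin n)} (h : IsHamPathGraph H) (a : Fin n) :
    (Finset.univ.filter (fun b => H.Adj a b)).card ≤ 2 := by
  obtain ⟨σ, hσ⟩ := h
  have : ((Finset.univ.filter (fun b => H.Adj a b)).image (fun b => (σ b).val)) ⊆
      {(σ a).val + 1, (σ a).val - 1} := by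
    intro y hy
    simp only [Finset.mem_image, Finset.mem_filter, Finset.mem_univ, true_and] at hy
    obtain ⟨b, hb, rfl⟩ := hy
    rw [hσ, pathGraph_adj] at hb
    simp only [Finset.mem_insert, Finset.mem_singleton]
    omega
  have hc := Finset.card_le_card this
  rw [Finset.card_image_of_injective] at hc
  · exact hc.trans Finset.card_le_two
  · intro x y hxy
    exact σ.injective (Fin.ext hxy)

open Classical in
lemma hp_edges {n : ℕ} {H : SimpleGraph (Fin n)} (h : IsHamPathGraph H) :
    H.edgeFinset.card ≤ n := by
  have h1 := H.sum_degrees_eq_twice_card_edges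
  have h2 : ∑ v, H.degree v ≤ ∑ v : Fin n, 2 := by
    apply Finset.sum_le_sum
    intro v _
    have := hp_degree h v
    have e : H.degree v = (Finset.univ.filter (fun b => H.Adj v b)).card := by
      rw [← SimpleGraph.card_neighborFinset_eq_degree]
      congr 1
      ext b
      simp
    rw [e]
    exact this
  simp at h2
  omega

lemma walk_split {V : Type*} {G : SimpleGraph V} {x y : V} (w : G.Walk x y) (e : Sym2 V)
    (he : e ∈ w.edges) : ∃ (a b : V) (h : G.Adj a b) (p : G.Walk x a) (q : G.Walk b y),
      e = s(a, b) ∧ w = p.append (SimpleGraph.Walk.cons h q) := by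
  induction w with
  | nil => simp at he
  | @cons u v z h p ih =>
    rw [SimpleGraph.Walk.edges_cons, List.mem_cons] at he
    rcases he with he | he
    · exact ⟨u, v, h, .nil, p, he, rfl⟩
    · obtain ⟨a, b, h', p', q', he', hp'⟩ := ih he
      exact ⟨a, b, h', .cons h p', q', he', by simp [hp']⟩

/-- The `i`-th edge of a vertex sequence. -/
def pe {V : Type*} {m : ℕ} (v : Fin (m + 1) → V) (i : Fin m) : Sym2 V :=
  s(v i.castSucc, v i.succ)

/-- The closing edge of a vertex sequence. -/
def ce {V : Type*} {m : ℕ} (v : Fin (m + 1) → V) : Sym2 V :=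
  s(v (Fin.last m), v 0)

/-- All the edges of the closed sequence are distinct. -/
def Good {V : Type*} {m : ℕ} (v : Fin (m + 1) → V) : Prop :=
  Function.Injective (pe v) ∧ ∀ i, pe v i ≠ ce v

lemma cycle_seq {V : Type*} {G : SimpleGraph V} {u : V} (w : G.Walk u u) (hw : w.IsCycle)
    {m : ℕ} (hm : w.length = m + 1) (e : Sym2 V) (he : e ∈ w.edges) :
    ∃ v : Fin (m + 1) → V, Good v ∧ (∀ i, pe v i ∈ w.edges) ∧ ce v = e := by
  obtain ⟨a, b, h, p, q, rfl, hpq⟩ := walk_split w e he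
  have hnd := hw.edges_nodup
  set r := q.append p with hr
  have hlen : r.length = m := by
    rw [hpq] at hm
    simp at hm
    simp [hr]
    omega
  have hperm : w.edges.Perm (s(a, b) :: r.edges) := by
    rw [hpq, hr]
    simp only [SimpleGraph.Walk.edges_append, SimpleGraph.Walk.edges_cons]
    exact List.perm_middle.trans (List.Perm.cons _ List.perm_append_comm)
  rw [hperm.nodup_iff, List.nodup_cons] at hnd
  have hpe : ∀ i : Fin m, pe (fun j : Fin (m + 1) => r.getVert j) i =
      r.edges[i.val]'(by simp [hlen]) := by
    intro i
    rw [SimpleGraph.Walk.getElem_edges]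
    simp [pe]
  have hce : ce (fun j : Fin (m + 1) => r.getVert j) = s(a, b) := by
    simp only [ce, Fin.val_last, Fin.val_zero, SimpleGraph.Walk.getVert_zero]
    rw [← hlen, SimpleGraph.Walk.getVert_length]
  refine ⟨fun j => r.getVert j, ⟨?_, ?_⟩, ?_, hce⟩
  · intro i j hij
    rw [hpe, hpe] at hij
    exact Fin.ext ((List.Nodup.getElem_inj_iff hnd.2).1 hij)
  · intro i hi
    rw [hce, hpe] at hi
    exact hnd.1 (hi ▸ List.getElem_mem _)
  · intro i
    rw [hperm.mem_iff, hpe]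
    exact List.mem_cons_of_mem _ (List.getElem_mem _)

lemma walk_weight {V : Type*} [Fintype V] (w : V → V → ℝ) (hw : ∀ a b, 0 ≤ w a b) (B : ℝ)
    (hB : ∀ a, ∑ b, w a b ≤ B) (m : ℕ) (a : V) :
    ∑ v : Fin m → V, ∏ i : Fin m, w ((Fin.cons a v : Fin (m + 1) → V) i.castSucc) (v i)
      ≤ B ^ m := by
  induction m generalizing a with
  | zero => simp
  | succ m ih =>
    rw [← (Fin.consEquiv (fun _ : Fin (m + 1) => V)).sum_comp, Fintype.sum_prod_type]
    have hB0 : 0 ≤ B := (Finset.sum_nonneg fun b _ => hw a b).trans (hB a)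
    calc _ = ∑ b, w a b * ∑ v : Fin m → V,
          ∏ i : Fin m, w ((Fin.cons b v : Fin (m + 1) → V) i.castSucc) (v i) := by
          refine Finset.sum_congr rfl fun b _ => ?_
          rw [Finset.mul_sum]
          refine Finset.sum_congr rfl fun v _ => ?_
          rw [Fin.prod_univ_succ]
          simp [Fin.consEquiv]
      _ ≤ ∑ b, w a b * B ^ m := by
          gcongr with b _
          · exact hw a b
          · exact ih b
      _ = (∑ b, w a b) * B ^ m := by rw [Finset.sum_mul]
      _ ≤ B * B ^ m := by gcongr; exact hB a
      _ = B ^ (m + 1) := by ring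

lemma walk_weight' {V : Type*} [Fintype V] (w : V → V → ℝ) (hw : ∀ a b, 0 ≤ w a b) (B : ℝ)
    (hB : ∀ a, ∑ b, w a b ≤ B) (m : ℕ) :
    ∑ v : Fin (m + 1) → V, ∏ i : Fin m, w (v i.castSucc) (v i.succ)
      ≤ Fintype.card V * B ^ m := by
  rw [← (Fin.consEquiv (fun _ : Fin (m + 1) => V)).sum_comp, Fintype.sum_prod_type]
  calc _ ≤ ∑ a : V, B ^ m := by
        refine Finset.sum_le_sum fun a _ => ?_
        have := walk_weight w hw B hB m a
        simpa [Fin.consEquiv] using this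
    _ = _ := by simp

open Classical in
lemma count_colorings {E : Type*} [Fintype E] (r : ℕ) (S : Finset E) :
    ((Finset.univ.filter (fun c : E → Fin (r + 1) => ∀ e ∈ S, c e = 0)).card : ℝ)
      = ((r : ℝ) + 1) ^ (Fintype.card E) / ((r : ℝ) + 1) ^ S.card := by
  have h : Finset.univ.filter (fun c : E → Fin (r + 1) => ∀ e ∈ S, c e = 0) =
      Fintype.piFinset (fun e => if e ∈ S then {0} else Finset.univ) := by
    ext c
    simp only [Finset.mem_filter, Finset.mem_univ, true_and, Fintype.mem_piFinset]
    refine forall_congr' fun e => ?_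
    by_cases he : e ∈ S <;> simp [he]
  rw [h, Fintype.card_piFinset]
  have hp : ((r : ℝ) + 1) ≠ 0 := by positivity
  rw [eq_div_iff (by positivity)]
  have : ∏ e, (if e ∈ S then ({0} : Finset (Fin (r + 1))) else Finset.univ).card
      = (r + 1) ^ (Fintype.card E - S.card) := by
    have : ∀ e, (if e ∈ S then ({0} : Finset (Fin (r + 1))) else Finset.univ).card
      = if e ∈ S then 1 else (r + 1) := by
      intro e; split_ifs <;> simp
    simp_rw [this]
    rw [Finset.prod_ite]
    simp only [Finset.prod_const_one, one_mul, Finset.prod_const]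
    congr 1
    rw [← Finset.card_compl]
    congr 1
    ext; simp
  rw [this]
  push_cast
  rw [← pow_add, Nat.sub_add_cancel (Finset.card_le_univ S)]

lemma count_colorings' {E : Type*} [Fintype E] (r : ℕ) (S : Finset E)
    (A : Finset (E → Fin (r + 1))) (hA : ∀ c, c ∈ A ↔ ∀ e ∈ S, c e = 0) :
    (A.card : ℝ) = ((r : ℝ) + 1) ^ (Fintype.card E) / ((r : ℝ) + 1) ^ S.card := by
  classical
  rw [← count_colorings]
  congr 2
  ext c
  rw [hA]
  simp

open Classical in
/-- The edges of colour zero which close a cycle of colour zero. -/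
noncomputable def Dset {n : ℕ} (m r : ℕ) (c : Sym2 (Fin n) → Fin (r + 1)) :
    Finset (Sym2 (Fin n)) :=
  Finset.univ.filter (fun e => ∃ v : Fin (m + 1) → Fin n,
    Good v ∧ (∀ i, c (pe v i) = 0) ∧ c (ce v) = 0 ∧ ce v = e)

open Classical in
/-- The edges of the closed sequence. -/
noncomputable def Eset {n m : ℕ} (v : Fin (m + 1) → Fin n) : Finset (Sym2 (Fin n)) :=
  insert (ce v) (Finset.univ.image (pe v))

open Classical in
lemma clique_bound {n m r : ℕ} (c : Sym2 (Fin n) → Fin (r + 1))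
    (F : Finset (SimpleGraph (Fin n))) (hF : ∀ G ∈ F, IsHamPathGraph G)
    (hC : ∀ G₁ ∈ F, ∀ G₂ ∈ F, G₁ ≠ G₂ → ContainsCycleLen (G₁ ⊔ G₂) (m + 1)) :
    (F.filter (fun P => ∀ e ∈ P.edgeFinset, c e = 0)).card ≤ 2 ^ (Dset m r c).card := by
  rw [← Finset.card_powerset]
  apply Finset.card_le_card_of_injOn (fun P => (Dset m r c).filter (fun e => e ∈ P.edgeSet))
  · intro P _
    simp only [Finset.coe_powerset, Set.mem_preimage, Set.mem_powerset_iff, Finset.coe_subset]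
    exact Finset.filter_subset _ _
  · intro P hP Q hQ hPQ
    simp only [Finset.mem_coe, Finset.mem_filter] at hP hQ
    by_contra hne
    obtain ⟨u, w, hw, hl⟩ := hC P hP.1 Q hQ.1 hne
    have hor : ∀ e ∈ w.edges, e ∈ P.edgeSet ∨ e ∈ Q.edgeSet := by
      intro e he
      have := w.edges_subset_edgeSet he
      rwa [SimpleGraph.edgeSet_sup] at this
    have hcol : ∀ e ∈ w.edges, c e = 0 := by
      intro e he
      rcases hor e he with h | h
      · exact hP.2 e (by simpa using h)
      · exact hQ.2 e (by simpa using h)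
    have hall : ∀ e ∈ w.edges, e ∈ P.edgeSet := by
      intro e he
      have hD : e ∈ Dset m r c := by
        obtain ⟨v, hv, h1, h2⟩ := cycle_seq w hw hl e he
        simp only [Dset, Finset.mem_filter, Finset.mem_univ, true_and]
        exact ⟨v, hv, fun i => hcol _ (h1 i), h2 ▸ hcol e he, h2⟩
      rcases hor e he with h | h
      · exact h
      · have : e ∈ (Dset m r c).filter (fun e => e ∈ Q.edgeSet) := by
          rw [Finset.mem_filter]; exact ⟨hD, h⟩
        have hPQ' : (Dset m r c).filter (fun e => e ∈ P.edgeSet) =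
          (Dset m r c).filter (fun e => e ∈ Q.edgeSet) := hPQ
        rw [← hPQ', Finset.mem_filter] at this
        exact this.2
    exact hp_acyclic (hF P hP.1) (w.transfer P hall) (hw.transfer hall)

open Classical in
lemma D_bound {n m r : ℕ} (c : Sym2 (Fin n) → Fin (r + 1)) (P : SimpleGraph (Fin n)) :
    (Dset m r c).card ≤ P.edgeFinset.card +
      ((Finset.univ.filter (fun v : Fin (m + 1) → Fin n => Good v ∧ ce v ∉ P.edgeSet)).filter
        (fun v => ∀ e ∈ Eset v, c e = 0)).card := by
  have : Dset m r c ⊆ P.edgeFinset ∪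
      (((Finset.univ.filter (fun v : Fin (m + 1) → Fin n => Good v ∧ ce v ∉ P.edgeSet)).filter
        (fun v => ∀ e ∈ Eset v, c e = 0)).image ce) := by
    intro e he
    simp only [Dset, Finset.mem_filter, Finset.mem_univ, true_and] at he
    obtain ⟨v, hv, h1, h2, rfl⟩ := he
    rw [Finset.mem_union]
    by_cases hP : ce v ∈ P.edgeSet
    · left; simpa using hP
    · right
      refine Finset.mem_image_of_mem _ ?_
      simp only [Finset.mem_filter, Finset.mem_univ, true_and]
      refine ⟨⟨hv, hP⟩, ?_⟩
      intro e he
      simp only [Eset, Finset.mem_insert, Finset.mem_image, Finset.mem_univ, true_and] at he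
      rcases he with rfl | ⟨i, rfl⟩
      · exact h2
      · exact h1 i
  refine (Finset.card_le_card this).trans ((Finset.card_union_le _ _).trans ?_)
  gcongr
  exact Finset.card_image_le

open Classical in
lemma card_union_Eset {n m : ℕ} (r : ℕ) (P : SimpleGraph (Fin n)) (v : Fin (m + 1) → Fin n)
    (hv : Good v) (hc : ce v ∉ P.edgeSet) :
    1 / ((r : ℝ) + 1) ^ (P.edgeFinset ∪ Eset v).card =
      1 / ((r : ℝ) + 1) ^ P.edgeFinset.card * ((1 / ((r : ℝ) + 1)) *
        ∏ i : Fin m, (if P.Adj (v i.castSucc) (v i.succ) then (1 : ℝ) else 1 / ((r : ℝ) + 1))) := by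
  have h1 : (P.edgeFinset ∪ Eset v) = P.edgeFinset ∪ (insert (ce v)
      ((Finset.univ.filter (fun i => ¬ P.Adj (v i.castSucc) (v i.succ))).image (pe v))) := by
    ext e
    simp only [Eset, Finset.mem_union, Finset.mem_insert, Finset.mem_image, Finset.mem_filter,
      Finset.mem_univ, true_and, SimpleGraph.mem_edgeFinset]
    constructor
    · rintro (h | h | ⟨i, rfl⟩)
      · exact Or.inl h
      · exact Or.inr (Or.inl h)
      · by_cases hi : P.Adj (v i.castSucc) (v i.succ)
        · left; exact hi
        · exact Or.inr (Or.inr ⟨i, hi, rfl⟩)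
    · rintro (h | h | ⟨i, _, rfl⟩)
      · exact Or.inl h
      · exact Or.inr (Or.inl h)
      · exact Or.inr (Or.inr ⟨i, rfl⟩)
  rw [h1, Finset.card_union_of_disjoint, Finset.card_insert_of_notMem,
    Finset.card_image_of_injective _ hv.1, Finset.prod_ite]
  · simp only [Finset.prod_const_one, one_mul, Finset.prod_const, one_div, inv_pow]
    rw [pow_add, pow_succ, mul_inv, mul_inv]
    ring
  · intro h
    rw [Finset.mem_image] at h
    obtain ⟨i, _, hi⟩ := h
    exact hv.2 i hi
  · rw [Finset.disjoint_left]
    intro e he h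
    rw [Finset.mem_insert, Finset.mem_image] at h
    rw [SimpleGraph.mem_edgeFinset] at he
    rcases h with rfl | ⟨i, hi, rfl⟩
    · exact hc he
    · simp only [Finset.mem_filter, Finset.mem_univ, true_and] at hi
      exact hi he

open Classical in
lemma weight_total {n m : ℕ} (r : ℕ) (P : SimpleGraph (Fin n)) (hP : IsHamPathGraph P) :
    ∑ v ∈ Finset.univ.filter (fun v : Fin (m + 1) → Fin n => Good v ∧ ce v ∉ P.edgeSet),
      1 / ((r : ℝ) + 1) ^ (P.edgeFinset ∪ Eset v).card ≤
      1 / ((r : ℝ) + 1) ^ P.edgeFinset.card *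
        ((1 / ((r : ℝ) + 1)) * (n * (2 + n / ((r : ℝ) + 1)) ^ m)) := by
  set w : Fin n → Fin n → ℝ := fun a b => if P.Adj a b then (1 : ℝ) else 1 / ((r : ℝ) + 1) with hw
  have hw0 : ∀ a b, 0 ≤ w a b := by
    intro a b
    simp only [hw]
    split_ifs <;> positivity
  have hB : ∀ a, ∑ b, w a b ≤ 2 + n / ((r : ℝ) + 1) := by
    intro a
    simp only [hw]
    rw [Finset.sum_ite]
    simp only [Finset.sum_const, nsmul_eq_mul, mul_one]
    have h1 : ((Finset.univ.filter (fun b => P.Adj a b)).card : ℝ) ≤ 2 := by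
      exact_mod_cast hp_degree hP a
    have h2 : ((Finset.univ.filter (fun b => ¬ P.Adj a b)).card : ℝ) ≤ n := by
      have := Finset.card_le_univ (Finset.univ.filter (fun b => ¬ P.Adj a b))
      rw [Fintype.card_fin] at this
      exact_mod_cast this
    have h3 : ((Finset.univ.filter (fun b => ¬ P.Adj a b)).card : ℝ) * (1 / ((r : ℝ) + 1)) ≤
        n / ((r : ℝ) + 1) := by
      rw [mul_one_div]
      gcongr
    linarith
  calc _ = ∑ v ∈ Finset.univ.filter (fun v : Fin (m + 1) → Fin n => Good v ∧ ce v ∉ P.edgeSet),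
        1 / ((r : ℝ) + 1) ^ P.edgeFinset.card * ((1 / ((r : ℝ) + 1)) *
        ∏ i : Fin m, w (v i.castSucc) (v i.succ)) := by
        refine Finset.sum_congr rfl fun v hv => ?_
        simp only [Finset.mem_filter, Finset.mem_univ, true_and] at hv
        exact card_union_Eset r P v hv.1 hv.2
    _ ≤ ∑ v : Fin (m + 1) → Fin n,
        1 / ((r : ℝ) + 1) ^ P.edgeFinset.card * ((1 / ((r : ℝ) + 1)) *
        ∏ i : Fin m, w (v i.castSucc) (v i.succ)) := by
        apply Finset.sum_le_sum_of_subset_of_nonneg (Finset.filter_subset _ _)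
        intro v _ _
        have : 0 ≤ ∏ i : Fin m, w (v i.castSucc) (v i.succ) :=
          Finset.prod_nonneg fun i _ => hw0 _ _
        positivity
    _ ≤ _ := by
        rw [← Finset.mul_sum, ← Finset.mul_sum]
        have := walk_weight' w hw0 _ hB m
        rw [Fintype.card_fin] at this
        gcongr

set_option maxHeartbeats 800000 in
open Classical in
lemma half_good {n m r s : ℕ} (P : SimpleGraph (Fin n)) (hP : IsHamPathGraph P) (hs0 : 0 < s)
    (hs : 2 * ((n : ℝ) + (1 / ((r : ℝ) + 1)) * (n * (2 + n / ((r : ℝ) + 1)) ^ m)) ≤ s) :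
    ((r : ℝ) + 1) ^ (Fintype.card (Sym2 (Fin n))) / ((r : ℝ) + 1) ^ n / 2 ≤
      ((Finset.univ.filter (fun c : Sym2 (Fin n) → Fin (r + 1) =>
        (∀ e ∈ P.edgeFinset, c e = 0) ∧ (Dset m r c).card ≤ s)).card : ℝ) := by
  set M := Fintype.card (Sym2 (Fin n)) with hM
  set S : ℝ := (1 / ((r : ℝ) + 1)) * (n * (2 + n / ((r : ℝ) + 1)) ^ m) with hS
  set A := Finset.univ.filter (fun c : Sym2 (Fin n) → Fin (r + 1) =>
    ∀ e ∈ P.edgeFinset, c e = 0) with hA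
  set X := Finset.univ.filter (fun v : Fin (m + 1) → Fin n => Good v ∧ ce v ∉ P.edgeSet) with hX
  have hAc : (A.card : ℝ) = ((r : ℝ) + 1) ^ M / ((r : ℝ) + 1) ^ P.edgeFinset.card :=
    count_colorings' r P.edgeFinset A (fun c => by simp only [hA, Finset.mem_filter, Finset.mem_univ, true_and])
  have hsum : ∑ c ∈ A, ((Dset m r c).card : ℝ) ≤ A.card * (n + S) := by
    calc _ ≤ ∑ c ∈ A, ((n : ℝ) + ∑ v ∈ X, if ∀ e ∈ Eset v, c e = 0 then (1 : ℝ) else 0) := by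
          refine Finset.sum_le_sum fun c _ => ?_
          have h1 := D_bound (m := m) c P
          have h2 := hp_edges hP
          rw [← hX] at h1
          rw [Finset.sum_boole]
          exact_mod_cast h1.trans (by gcongr)
      _ = A.card * n + ∑ v ∈ X, ∑ c ∈ A, if ∀ e ∈ Eset v, c e = 0 then (1 : ℝ) else 0 := by
          rw [Finset.sum_add_distrib, Finset.sum_comm]
          simp
      _ = A.card * n + ∑ v ∈ X, ((r : ℝ) + 1) ^ M *
            (1 / ((r : ℝ) + 1) ^ (P.edgeFinset ∪ Eset v).card) := by
          congr 1
          refine Finset.sum_congr rfl fun v _ => ?_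
          rw [Finset.sum_boole, mul_one_div]
          refine count_colorings' r _ _ fun c => ?_
          simp only [hA, Finset.mem_filter, Finset.mem_univ, true_and, Finset.mem_union]
          constructor
          · rintro ⟨h1, h2⟩ e (h | h)
            · exact h1 e h
            · exact h2 e h
          · intro h
            exact ⟨fun e he => h e (Or.inl he), fun e he => h e (Or.inr he)⟩
      _ ≤ A.card * n + ((r : ℝ) + 1) ^ M * (1 / ((r : ℝ) + 1) ^ P.edgeFinset.card * S) := by
          rw [← Finset.mul_sum]
          gcongr
          exact weight_total r P hP
      _ = A.card * (n + S) := by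
          rw [hAc]; ring
  set Gd := A.filter (fun c => (Dset m r c).card ≤ s) with hGd
  set Bd := A.filter (fun c => ¬ (Dset m r c).card ≤ s) with hBd
  have hsplit : (Gd.card : ℝ) + Bd.card = A.card := by
    exact_mod_cast Finset.card_filter_add_card_filter_not (s := A) (fun c => (Dset m r c).card ≤ s)
  have hbad : (Bd.card : ℝ) * s ≤ A.card * (n + S) := by
    refine le_trans ?_ hsum
    calc (Bd.card : ℝ) * s = ∑ c ∈ Bd, (s : ℝ) := by simp
      _ ≤ ∑ c ∈ Bd, ((Dset m r c).card : ℝ) := by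
          refine Finset.sum_le_sum fun c hc => ?_
          rw [hBd, Finset.mem_filter] at hc
          exact_mod_cast (not_le.1 hc.2).le
      _ ≤ _ := by
          apply Finset.sum_le_sum_of_subset_of_nonneg (Finset.filter_subset _ _)
          intros; positivity
  have hs0' : (0 : ℝ) < s := by exact_mod_cast hs0
  have hbad2 : (Bd.card : ℝ) ≤ A.card / 2 := by
    have : (Bd.card : ℝ) * s ≤ A.card / 2 * s := by
      refine hbad.trans ?_
      have : (0 : ℝ) ≤ A.card := by positivity
      nlinarith
    exact le_of_mul_le_mul_right this hs0'
  have hAge : ((r : ℝ) + 1) ^ M / ((r : ℝ) + 1) ^ n ≤ A.card := by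
    rw [hAc]
    gcongr
    · linarith [(Nat.cast_nonneg r : (0 : ℝ) ≤ r)]
    · exact hp_edges hP
  have hfin : (Finset.univ.filter (fun c : Sym2 (Fin n) → Fin (r + 1) =>
        (∀ e ∈ P.edgeFinset, c e = 0) ∧ (Dset m r c).card ≤ s)) = Gd := by
    rw [hGd, hA, Finset.filter_filter]
  rw [hfin]
  linarith

open Classical in
lemma key_s5 {n m r s : ℕ} (F : Finset (SimpleGraph (Fin n))) (hF : ∀ G ∈ F, IsHamPathGraph G)
    (hC : ∀ G₁ ∈ F, ∀ G₂ ∈ F, G₁ ≠ G₂ → ContainsCycleLen (G₁ ⊔ G₂) (m + 1)) (hs0 : 0 < s)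
    (hs : 2 * ((n : ℝ) + (1 / ((r : ℝ) + 1)) * (n * (2 + n / ((r : ℝ) + 1)) ^ m)) ≤ s) :
    (F.card : ℝ) ≤ 2 * 2 ^ s * ((r : ℝ) + 1) ^ n := by
  set M := Fintype.card (Sym2 (Fin n)) with hM
  have h1 : (F.card : ℝ) * (((r : ℝ) + 1) ^ M / ((r : ℝ) + 1) ^ n / 2) ≤
      ((r : ℝ) + 1) ^ M * 2 ^ s := by
    calc _ = ∑ P ∈ F, (((r : ℝ) + 1) ^ M / ((r : ℝ) + 1) ^ n / 2) := by simp
      _ ≤ ∑ P ∈ F, ∑ c : Sym2 (Fin n) → Fin (r + 1),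
          (if (∀ e ∈ P.edgeFinset, c e = 0) ∧ (Dset m r c).card ≤ s then (1 : ℝ) else 0) := by
          refine Finset.sum_le_sum fun P hP => ?_
          rw [Finset.sum_boole]
          exact half_good P (hF P hP) hs0 hs
      _ = ∑ c : Sym2 (Fin n) → Fin (r + 1), ∑ P ∈ F,
          (if (∀ e ∈ P.edgeFinset, c e = 0) ∧ (Dset m r c).card ≤ s then (1 : ℝ) else 0) :=
          Finset.sum_comm
      _ ≤ ∑ c : Sym2 (Fin n) → Fin (r + 1), (2 : ℝ) ^ s := by
          refine Finset.sum_le_sum fun c _ => ?_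
          by_cases hD : (Dset m r c).card ≤ s
          · simp only [hD, and_true]
            rw [Finset.sum_boole]
            have := (clique_bound (m := m) c F hF hC).trans
              (Nat.pow_le_pow_right (by norm_num) hD)
            exact_mod_cast this
          · simp [hD]
      _ = _ := by
          simp [hM]
  have hp : (0 : ℝ) < ((r : ℝ) + 1) ^ M := by positivity
  have hq : (0 : ℝ) < ((r : ℝ) + 1) ^ n := by positivity
  have h2 : (F.card : ℝ) * (((r : ℝ) + 1) ^ M / ((r : ℝ) + 1) ^ n / 2) =
    ((r : ℝ) + 1) ^ M * ((F.card : ℝ) / (2 * ((r : ℝ) + 1) ^ n)) := by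
    field_simp
  rw [h2] at h1
  have h3 := le_of_mul_le_mul_left h1 hp
  rw [div_le_iff₀ (by positivity)] at h3
  linarith

lemma final_bound (k : ℕ) (hk : 2 ≤ k) (n : ℕ) (hn : 1 ≤ n) (F : Finset (SimpleGraph (Fin n)))
    (hF : ∀ G ∈ F, IsHamPathGraph G)
    (hC : ∀ G₁ ∈ F, ∀ G₂ ∈ F, G₁ ≠ G₂ → ContainsCycleLen (G₁ ⊔ G₂) (2 * k)) :
    (F.card : ℝ) ≤ (4 * 2 ^ (2 * (1 + 9 ^ k)) : ℝ) ^ n *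
      (n : ℝ) ^ ((1 - 1 / (2 * (k : ℝ))) * n) := by
  have hn1 : (1 : ℝ) ≤ n := by exact_mod_cast hn
  have hn0 : (0 : ℝ) < n := by linarith
  have hk2 : (2 : ℝ) ≤ k := by exact_mod_cast hk
  set a : ℝ := 1 - 1 / (2 * (k : ℝ)) with ha
  have ha0 : 0 ≤ a := by
    rw [ha, sub_nonneg, div_le_one (by linarith)]
    linarith
  set r := ⌊(n : ℝ) ^ a⌋₊ with hr
  set t : ℝ := (n : ℝ) ^ (1 / (2 * (k : ℝ))) with ht
  have hna : 1 ≤ (n : ℝ) ^ a := Real.one_le_rpow hn1 ha0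
  have ht1 : 1 ≤ t := Real.one_le_rpow hn1 (by positivity)
  have htk : t ^ (2 * k) = n := by
    rw [ht, ← Real.rpow_natCast, ← Real.rpow_mul hn0.le]
    have : 1 / (2 * (k : ℝ)) * ((2 * k : ℕ) : ℝ) = 1 := by
      push_cast
      field_simp
    rw [this, Real.rpow_one]
  have hta : t * (n : ℝ) ^ a = n := by
    rw [ht, ← Real.rpow_add hn0, ha]
    simp
  have hr1 : (n : ℝ) ^ a ≤ (r : ℝ) + 1 := (Nat.lt_floor_add_one _).le
  have hr2 : (r : ℝ) + 1 ≤ 2 * (n : ℝ) ^ a := by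
    have := Nat.floor_le (zero_le_one.trans hna)
    linarith
  have hd : (n : ℝ) / ((r : ℝ) + 1) ≤ t := by
    rw [div_le_iff₀ (by positivity)]
    calc (n : ℝ) = t * (n : ℝ) ^ a := hta.symm
      _ ≤ _ := by gcongr
  obtain ⟨m, hm⟩ : ∃ m, 2 * k = m + 1 := ⟨2 * k - 1, by omega⟩
  have h9 : (3 * t) ^ (2 * k) = 9 ^ k * n := by
    rw [mul_pow, htk, pow_mul]
    norm_num
  have hkey := key_s5 (m := m) (r := r) (s := 2 * (1 + 9 ^ k) * n) F hF (hm ▸ hC) (by positivity) (by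
    have e1 : (1 / ((r : ℝ) + 1)) * (n * (2 + n / ((r : ℝ) + 1)) ^ m) ≤ 9 ^ k * n := by
      calc _ = (n / ((r : ℝ) + 1)) * (2 + n / ((r : ℝ) + 1)) ^ m := by ring
        _ ≤ (3 * t) * (3 * t) ^ m := by
            gcongr
            · linarith
            · linarith
        _ = (3 * t) ^ (2 * k) := by rw [hm]; ring
        _ = _ := h9
    push_cast
    linarith)
  refine hkey.trans ?_
  calc (2 : ℝ) * 2 ^ (2 * (1 + 9 ^ k) * n) * ((r : ℝ) + 1) ^ n
      ≤ 2 ^ n * 2 ^ (2 * (1 + 9 ^ k) * n) * (2 * (n : ℝ) ^ a) ^ n := by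
        gcongr
        exact le_self_pow₀ (by norm_num) (by omega)
    _ = _ := by
        rw [Real.rpow_mul hn0.le, Real.rpow_natCast, mul_pow, mul_pow, pow_mul]
        have : (4 : ℝ) ^ n = 2 ^ n * 2 ^ n := by rw [← mul_pow]; norm_num
        rw [this]
        ring

/-- Main theorem: `H(n,2k) ≤ n^((1 - 2/(3k² - 2k))n - o(n))` for every `k ≥ 2`. -/
theorem stmt_5 (k : ℕ) (hk : 2 ≤ k) :
    ∀ ε : ℝ, 0 < ε → ∃ N : ℕ, ∀ n : ℕ, N ≤ n →
      (Hnum n (2 * k) : ℝ) ≤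
        (n : ℝ) ^ ((1 - 2 / (3 * (k : ℝ) ^ 2 - 2 * k) + ε) * n) := by
  intro ε hε
  set C : ℝ := 4 * 2 ^ (2 * (1 + 9 ^ k)) with hCdef
  have htend := (tendsto_rpow_atTop hε).comp (tendsto_natCast_atTop_atTop (R := ℝ))
  obtain ⟨N, hN⟩ := Filter.eventually_atTop.1 (htend.eventually_ge_atTop C)
  refine ⟨max N 1, fun n hn => ?_⟩
  have hn1 : 1 ≤ n := (le_max_right _ _).trans hn
  have hnC : C ≤ (n : ℝ) ^ ε := hN n ((le_max_left _ _).trans hn)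
  have hnR : (1 : ℝ) ≤ n := by exact_mod_cast hn1
  have hn0 : (0 : ℝ) < n := by linarith
  have hk2 : (2 : ℝ) ≤ k := by exact_mod_cast hk
  have hmem : Hnum n (2 * k) ∈ {m | ∃ F : Finset (SimpleGraph (Fin n)), F.card = m ∧
    (∀ G ∈ F, IsHamPathGraph G) ∧
    ∀ G₁ ∈ F, ∀ G₂ ∈ F, G₁ ≠ G₂ → ContainsCycleLen (G₁ ⊔ G₂) (2 * k)} := by
    classical
    apply Nat.sSup_mem
    · exact ⟨0, ∅, by simp⟩
    · refine ⟨Fintype.card (SimpleGraph (Fin n)), ?_⟩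
      rintro _ ⟨F, rfl, _⟩
      exact Finset.card_le_univ F
  obtain ⟨F, hcard, hF, hC⟩ := hmem
  rw [← hcard]
  refine (final_bound k hk n hn1 F hF hC).trans ?_
  rw [← hCdef]
  have hexp : 2 / (3 * (k : ℝ) ^ 2 - 2 * k) ≤ 1 / (2 * (k : ℝ)) := by
    rw [div_le_div_iff₀ (by nlinarith) (by linarith)]
    nlinarith
  calc C ^ n * (n : ℝ) ^ ((1 - 1 / (2 * (k : ℝ))) * n)
      ≤ ((n : ℝ) ^ ε) ^ n * (n : ℝ) ^ ((1 - 1 / (2 * (k : ℝ))) * n) := by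
        gcongr
    _ = (n : ℝ) ^ ((1 - 1 / (2 * (k : ℝ)) + ε) * n) := by
        rw [← Real.rpow_natCast, ← Real.rpow_mul hn0.le, ← Real.rpow_add hn0]
        congr 1
        ring
    _ ≤ _ := by
        apply Real.rpow_le_rpow_of_exponent_le hnR
        gcongr
end
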